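/- arXiv:2604.23008 — 5 statements merged into one kernel-verified Lean document; each statement's English description precedes it below -/
import Mathlib

section
/- Let α ∈ (0,1] and λ ∈ ℝ. The function y(t) = exp(λ t^α / α) is continuous on [0,∞), differentiable on (0,∞), satisfies t^{1−α} y′(t) = λ y(t) for all t > 0 and y(0) = 1; moreover, it is the unique such function: any y : [0,∞) → ℝ continuous on [0,∞), differentiable on (0,∞), with t^{1−α} y′(t) = λ y(t) for all t > 0 and y(0) = 1 equals exp(λ t^α / α) for every t ≥ 0. -/
open Filter Topology

theorem continuous_exp_mul_rpow_div {α : ℝ} (hα : 0 < α) (c : ℝ) :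
    Continuous fun t : ℝ => Real.exp (c * t ^ α / α) :=
  Real.continuous_exp.comp
    ((continuous_const.mul (Real.continuous_rpow_const hα.le)).div_const α)

theorem hasDerivAt_exp_mul_rpow_div {α : ℝ} (hα : α ≠ 0) (c : ℝ) {t : ℝ} (ht : 0 < t) :
    HasDerivAt (fun t : ℝ => Real.exp (c * t ^ α / α))
      (c * t ^ (α - 1) * Real.exp (c * t ^ α / α)) t := by
  have h := (((Real.hasDerivAt_rpow_const (p := α) (Or.inl ht.ne')).const_mul c).div_const α).exp
  convert h using 1
  field_simp

theorem rpow_one_sub_mul_rpow_sub_one (α : ℝ) {t : ℝ} (ht : 0 < t) :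
    t ^ (1 - α) * t ^ (α - 1) = 1 := by
  rw [← Real.rpow_add ht, sub_add_sub_cancel, sub_self, Real.rpow_zero]

/-- The conformable exponential `y(t) = exp (λ t^α / α)` is continuous on `[0,∞)`,
differentiable on `(0,∞)`, satisfies `t^(1-α) y'(t) = λ y(t)` for `t > 0` and `y 0 = 1`;
moreover it is the unique such function. -/
theorem conformable_exponential_exists_unique
    (α lam : ℝ) (hα0 : 0 < α) (hα1 : α ≤ 1) :
    (ContinuousOn (fun t : ℝ => Real.exp (lam * t ^ α / α)) (Set.Ici 0)
      ∧ (∀ t : ℝ, 0 < t →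
          DifferentiableAt ℝ (fun t : ℝ => Real.exp (lam * t ^ α / α)) t
          ∧ t ^ (1 - α) * deriv (fun t : ℝ => Real.exp (lam * t ^ α / α)) t
              = lam * Real.exp (lam * t ^ α / α))
      ∧ Real.exp (lam * (0 : ℝ) ^ α / α) = 1)
    ∧ ∀ y : ℝ → ℝ, ContinuousOn y (Set.Ici 0) →
        (∀ t : ℝ, 0 < t → DifferentiableAt ℝ y t ∧ t ^ (1 - α) * deriv y t = lam * y t) →
        y 0 = 1 →
        ∀ t : ℝ, 0 ≤ t → y t = Real.exp (lam * t ^ α / α) := by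
  refine ⟨⟨(continuous_exp_mul_rpow_div hα0 lam).continuousOn, fun t ht => ?_, ?_⟩, ?_⟩
  · have h := hasDerivAt_exp_mul_rpow_div hα0.ne' lam ht
    refine ⟨h.differentiableAt, ?_⟩
    rw [h.deriv]
    linear_combination
      lam * Real.exp (lam * t ^ α / α) * rpow_one_sub_mul_rpow_sub_one α ht
  · simp [Real.zero_rpow hα0.ne']
  · intro y hy hd h0 t ht
    rcases ht.eq_or_lt with rfl | ht
    · simp [Real.zero_rpow hα0.ne', h0]
    have hderiv : ∀ s ∈ Set.Ioo 0 t,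
        HasDerivAt (fun s : ℝ => y s * Real.exp (-lam * s ^ α / α)) 0 s := by
      intro s hs
      obtain ⟨hys, hode⟩ := hd s hs.1
      refine (hys.hasDerivAt.mul
        (hasDerivAt_exp_mul_rpow_div hα0.ne' (-lam) hs.1)).congr_deriv ?_
      linear_combination Real.exp (-lam * s ^ α / α) *
        (s ^ (α - 1) * hode - deriv y s * rpow_one_sub_mul_rpow_sub_one α hs.1)
    obtain ⟨s, -, hs⟩ := exists_hasDerivAt_eq_slope
      (fun s : ℝ => y s * Real.exp (-lam * s ^ α / α)) (fun _ => 0) ht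
      ((hy.mono Set.Icc_subset_Ici_self).mul
        (continuous_exp_mul_rpow_div hα0 (-lam)).continuousOn) hderiv
    rw [eq_comm, div_eq_zero_iff, or_iff_left (sub_pos.2 ht).ne', sub_eq_zero] at hs
    simp only [h0, Real.zero_rpow hα0.ne', mul_zero, zero_div, Real.exp_zero, mul_one] at hs
    rwa [neg_mul, neg_div, Real.exp_neg, ← div_eq_mul_inv,
      div_eq_one_iff_eq (Real.exp_ne_zero _)] at hs
end

section
/- Let a, b, y₀ ∈ ℝ and T > 0. Define y : ℝ → ℝ by y(t) = 0 for t < 0 and, for t ≥ 0, y(t) = ∑_{j=0}^{⌊t/T⌋} (y₀ + b(t − jT)/(j+1)) (−a)^j (t − jT)^j / j!. Then y(0) = y₀; on the interval [0,T) one has y(t) = y₀ + b t; and for every t > 0 that is not an integer multiple of T, y is differentiable at t and y′(t) + a · y(t − T) = b. Thus y is the solution of the delay differential equation y′(t) + a y(t−T) = b with initial value y(0) = y₀ and y(t) = 0 for t < 0. -/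
open Filter Topology

/-- The `j`-th term of the series, as a function of the delayed time `s = t - j T`. -/
noncomputable def delayTerm (a b y₀ : ℝ) (j : ℕ) (s : ℝ) : ℝ :=
  (y₀ + b * s / ((j : ℝ) + 1)) * (-a) ^ j * s ^ j / (j.factorial : ℝ)

theorem hasDerivAt_delayTerm_zero (a b y₀ s : ℝ) : HasDerivAt (delayTerm a b y₀ 0) b s := by
  have h : delayTerm a b y₀ 0 = fun s => y₀ + b * s := by
    ext s
    simp [delayTerm]
  rw [h]
  simpa using ((hasDerivAt_id s).const_mul b).const_add y₀

theorem hasDerivAt_delayTerm_succ (a b y₀ : ℝ) (j : ℕ) (s : ℝ) :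
    HasDerivAt (delayTerm a b y₀ (j + 1)) (-a * delayTerm a b y₀ j s) s := by
  have h₁ := (((hasDerivAt_id s).const_mul b).div_const (((j + 1 : ℕ) : ℝ) + 1)).const_add y₀
  have h₂ := ((h₁.mul_const ((-a) ^ (j + 1))).mul ((hasDerivAt_id s).pow (j + 1))).div_const
    ((j + 1).factorial : ℝ)
  refine h₂.congr_deriv ?_
  have hf : (j.factorial : ℝ) ≠ 0 := by exact_mod_cast j.factorial_ne_zero
  have hj : (j : ℝ) + 1 ≠ 0 := by positivity
  have hj' : (j : ℝ) + 1 + 1 ≠ 0 := by positivity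
  simp only [delayTerm, Nat.factorial_succ, id, Pi.pow_apply, Nat.add_sub_cancel]
  push_cast
  field_simp
  ring

theorem hasDerivAt_sum_delayTerm (a b y₀ T : ℝ) (n : ℕ) (t : ℝ) :
    HasDerivAt (fun u => ∑ j ∈ Finset.range (n + 1), delayTerm a b y₀ j (u - j * T))
      (b - a * ∑ j ∈ Finset.range n, delayTerm a b y₀ j (t - T - j * T)) t := by
  have hsucc : ∀ j ∈ Finset.range n,
      HasDerivAt (fun u => delayTerm a b y₀ (j + 1) (u - (j + 1 : ℕ) * T))
        (-a * delayTerm a b y₀ j (t - T - j * T)) t := by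
    intro j _
    have ht : t - T - j * T = t - (j + 1 : ℕ) * T := by
      push_cast
      ring
    rw [ht]
    exact (hasDerivAt_delayTerm_succ a b y₀ j _).comp_sub_const t _
  have hzero := (hasDerivAt_delayTerm_zero a b y₀ (t - (0 : ℕ) * T)).comp_sub_const t
    ((0 : ℕ) * T)
  simp only [Finset.sum_range_succ']
  refine ((HasDerivAt.fun_sum hsucc).add hzero).congr_deriv ?_
  rw [← Finset.mul_sum]
  ring

/-- The explicit series (truncated by the Heaviside factors) solves the classical
delay differential equation `y'(t) + a y(t-T) = b` with `y(0) = y₀` and `y(t) = 0`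
for `t < 0`: it equals `y₀ + b t` on `[0,T)`, and at every `t > 0` which is not an
integer multiple of `T` it is differentiable with `y'(t) + a y(t-T) = b`. -/
theorem delay_ode_series_solution
    (a b y₀ T : ℝ) (hT : 0 < T)
    (y : ℝ → ℝ)
    (hneg : ∀ t : ℝ, t < 0 → y t = 0)
    (hdef : ∀ t : ℝ, 0 ≤ t → y t =
      ∑ j ∈ Finset.range (⌊t / T⌋₊ + 1),
        (y₀ + b * (t - (j : ℝ) * T) / ((j : ℝ) + 1)) * (-a) ^ j
          * (t - (j : ℝ) * T) ^ j / (j.factorial : ℝ)) :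
    y 0 = y₀
    ∧ (∀ t ∈ Set.Ico (0 : ℝ) T, y t = y₀ + b * t)
    ∧ ∀ t : ℝ, 0 < t → (∀ j : ℕ, t ≠ (j : ℝ) * T) →
        DifferentiableAt ℝ y t ∧ deriv y t + a * y (t - T) = b := by
  have hsum : ∀ (n : ℕ) (t : ℝ), n * T ≤ t → t < (n + 1) * T →
      y t = ∑ j ∈ Finset.range (n + 1), delayTerm a b y₀ j (t - j * T) := by
    intro n t h₁ h₂
    have ht : 0 ≤ t := le_trans (by positivity) h₁
    have hn : ⌊t / T⌋₊ = n :=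
      (Nat.floor_eq_iff (by positivity)).2 ⟨(le_div_iff₀ hT).2 h₁, (div_lt_iff₀ hT).2 h₂⟩
    rw [hdef t ht, hn]
    rfl
  have hinit : ∀ t ∈ Set.Ico (0 : ℝ) T, y t = y₀ + b * t := by
    intro t ht
    rw [hsum 0 t (by simpa using ht.1) (by simpa using ht.2)]
    simp [delayTerm]
  refine ⟨by simpa using hinit 0 ⟨le_rfl, hT⟩, hinit, fun t ht hne => ?_⟩
  obtain ⟨n, hn⟩ : ∃ n, ⌊t / T⌋₊ = n := ⟨_, rfl⟩
  obtain ⟨h₁, h₂⟩ := (Nat.floor_eq_iff (by positivity)).1 hn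
  rw [le_div_iff₀ hT] at h₁
  rw [div_lt_iff₀ hT] at h₂
  have hev : y =ᶠ[𝓝 t] fun u => ∑ j ∈ Finset.range (n + 1), delayTerm a b y₀ j (u - j * T) := by
    filter_upwards [Ioo_mem_nhds (lt_of_le_of_ne h₁ (hne n).symm) h₂] with u hu
    exact hsum n u hu.1.le hu.2
  have hdelay : y (t - T) = ∑ j ∈ Finset.range n, delayTerm a b y₀ j (t - T - j * T) := by
    cases n with
    | zero =>
      rw [hneg _ (by simpa using h₂)]
      simp
    | succ m =>
      push_cast at h₁ h₂
      exact hsum m (t - T) (by linarith) (by linarith)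
  have hderiv := (hasDerivAt_sum_delayTerm a b y₀ T n t).congr_of_eventuallyEq hev
  refine ⟨hderiv.differentiableAt, ?_⟩
  rw [hderiv.deriv, hdelay, sub_add_cancel]
end

section
/- Let α ∈ (0,1), T > 0, and let (b_k)_{k≥0} be real coefficients such that the power series ∑_{k=0}^∞ b_k z^k has infinite radius of convergence. Define y(t) := y₀ + ∑_{k=0}^∞ (Γ(αk+1)/α^k) b_k t^{(k+1)α}/Γ((k+1)α+1) for t ≥ 0. Then the series converges for every t ≥ 0, y(0) = y₀, and for every t > 0 the Caputo derivative of y satisfies (1/Γ(1−α)) ∫₀^t (t−τ)^{−α} y′(τ) dτ = ∑_{k=0}^∞ b_k (t^α/α)^k; that is, on [0,T) the function y solves the Caputo delay equation ^C D^α y(t) + a y(t−T) = b(t) with b(t) = ∑_k b_k (t^α/α)^k, since y(t−T) = 0 there. -/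
open Filter Topology intervalIntegral

/-- The candidate solution on the first delay interval for the Caputo delay equation
with analytic forcing `b(t) = ∑_k b_k (t^α/α)^k`. -/
noncomputable def caputoFirstIntervalSol (α y₀ : ℝ) (b : ℕ → ℝ) : ℝ → ℝ :=
  fun t => y₀ + ∑' k : ℕ,
    (Real.Gamma (α * (k : ℝ) + 1) / α ^ k) * b k
      * t ^ (((k : ℝ) + 1) * α) / Real.Gamma (((k : ℝ) + 1) * α + 1)

/-- Euler's beta integral on `[0, t]`, in real form. -/
theorem integral_sub_rpow_mul_rpow {u v t : ℝ} (hu : 0 < u) (hv : 0 < v) (ht : 0 < t) :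
    ∫ x in (0 : ℝ)..t, (t - x) ^ (v - 1) * x ^ (u - 1)
      = t ^ (u + v - 1) * (Real.Gamma u * Real.Gamma v / Real.Gamma (u + v)) := by
  have hscaled := Complex.betaIntegral_scaled (u : ℂ) (v : ℂ) ht
  rw [Complex.betaIntegral_eq_Gamma_mul_div _ _ (by simpa using hu) (by simpa using hv)] at hscaled
  apply Complex.ofReal_injective
  rw [← intervalIntegral.integral_ofReal]
  push_cast [Complex.ofReal_cpow ht.le, ← Complex.Gamma_ofReal]
  rw [← hscaled]
  refine intervalIntegral.integral_congr fun x hx => ?_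
  rw [Set.uIcc_of_le ht.le] at hx
  simp only [Complex.ofReal_cpow hx.1, Complex.ofReal_cpow (sub_nonneg.mpr hx.2)]
  push_cast
  ring

theorem intervalIntegrable_sub_rpow_mul_rpow {u v t : ℝ} (hu : 0 < u) (hv : 0 < v) (ht : 0 < t) :
    IntervalIntegrable (fun x => (t - x) ^ (v - 1) * x ^ (u - 1)) MeasureTheory.volume 0 t := by
  apply intervalIntegral.intervalIntegrable_of_integral_ne_zero
  rw [integral_sub_rpow_mul_rpow hu hv ht]
  have := Real.Gamma_pos_of_pos hu
  have := Real.Gamma_pos_of_pos hv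
  have := Real.Gamma_pos_of_pos (add_pos hu hv)
  positivity

theorem Gamma_le_two_mul_Gamma_add {x s : ℝ} (hx : 1 ≤ x) (hs0 : 0 ≤ s) (hs1 : s ≤ 1) :
    Real.Gamma x ≤ 2 * Real.Gamma (x + s) := by
  have hx0 : 0 < x := by linarith
  have hxs : 0 < x + s := by linarith
  have hmono : Real.Gamma (x + 1) ≤ Real.Gamma (x + s + 1) :=
    Real.Gamma_strictMonoOn_Ici.monotoneOn (by simp; linarith) (by simp; linarith) (by linarith)
  rw [Real.Gamma_add_one hx0.ne', Real.Gamma_add_one hxs.ne'] at hmono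
  have hpos := Real.Gamma_pos_of_pos hxs
  refine le_of_mul_le_mul_left (hmono.trans ?_) hx0
  nlinarith

theorem rpow_natCast_add_one_mul {α t : ℝ} (ht : 0 < t) (k : ℕ) (c : ℝ) :
    t ^ (((k : ℝ) + 1) * α + c) = t ^ (α + c) * (t ^ α) ^ k := by
  rw [← Real.rpow_natCast, ← Real.rpow_mul ht.le, ← Real.rpow_add ht]
  ring_nf

/-- The coefficient of `t ^ ((k + 1) * α)` in the series solution. -/
noncomputable def caputoCoeff (α : ℝ) (b : ℕ → ℝ) (k : ℕ) : ℝ :=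
  Real.Gamma (α * (k : ℝ) + 1) / α ^ k * b k / Real.Gamma (((k : ℝ) + 1) * α + 1)

section

variable {α : ℝ} {b : ℕ → ℝ}

theorem abs_caputoCoeff_le (hα0 : 0 < α) (hα1 : α < 1) (k : ℕ) :
    |caputoCoeff α b k| ≤ 2 * |b k| / α ^ k := by
  have hx : 0 ≤ α * (k : ℝ) := by positivity
  have hG := Gamma_le_two_mul_Gamma_add (x := α * k + 1) (by linarith) hα0.le hα1.le
  rw [show α * (k : ℝ) + 1 + α = ((k : ℝ) + 1) * α + 1 by ring] at hG
  have h1 : 0 < Real.Gamma (α * (k : ℝ) + 1) := Real.Gamma_pos_of_pos (by positivity)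
  have h2 : 0 < Real.Gamma (((k : ℝ) + 1) * α + 1) := Real.Gamma_pos_of_pos (by positivity)
  have hαk : 0 < α ^ k := by positivity
  rw [caputoCoeff, abs_div, abs_mul, abs_div, abs_of_pos h1, abs_of_pos h2, abs_of_pos hαk,
    div_le_iff₀ h2]
  calc _ ≤ 2 * Real.Gamma (((k : ℝ) + 1) * α + 1) / α ^ k * |b k| := by gcongr
    _ = _ := by ring

theorem summable_abs_caputoCoeff (hα0 : 0 < α) (hα1 : α < 1)
    (hb : ∀ r : ℝ, 0 ≤ r → Summable (fun k : ℕ => |b k| * r ^ k)) {r : ℝ} (hr : 0 ≤ r) :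
    Summable fun k : ℕ => ((k : ℝ) + 1) * |caputoCoeff α b k| * r ^ k := by
  refine Summable.of_nonneg_of_le (fun k => by positivity) (fun k => ?_)
    ((hb (2 * r / α) (by positivity)).mul_left 2)
  have hk : (k : ℝ) + 1 ≤ 2 ^ k := by exact_mod_cast Nat.lt_two_pow_self
  calc _ ≤ 2 ^ k * (2 * |b k| / α ^ k) * r ^ k := by
        gcongr
        exact abs_caputoCoeff_le hα0 hα1 k
    _ = _ := by rw [div_pow, mul_pow]; ring

theorem summable_caputoCoeff_mul_rpow (hα0 : 0 < α) (hα1 : α < 1)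
    (hb : ∀ r : ℝ, 0 ≤ r → Summable (fun k : ℕ => |b k| * r ^ k)) {t : ℝ} (ht : 0 ≤ t) :
    Summable fun k : ℕ => caputoCoeff α b k * t ^ (((k : ℝ) + 1) * α) := by
  rcases ht.eq_or_lt with rfl | ht
  · refine summable_zero.congr fun k => ?_
    rw [Real.zero_rpow (by positivity), mul_zero]
  refine Summable.of_norm_bounded
    ((summable_abs_caputoCoeff hα0 hα1 hb (Real.rpow_nonneg ht.le α)).mul_left (t ^ α)) fun k => ?_
  have h := rpow_natCast_add_one_mul (α := α) ht k 0
  rw [add_zero, add_zero] at h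
  rw [h, norm_mul, Real.norm_eq_abs, Real.norm_of_nonneg (by positivity)]
  have hk : (1 : ℝ) ≤ (k : ℝ) + 1 := by simp
  calc _ = t ^ α * (1 * |caputoCoeff α b k| * (t ^ α) ^ k) := by ring
    _ ≤ _ := by gcongr

theorem caputoFirstIntervalSol_eq (α y₀ : ℝ) (b : ℕ → ℝ) :
    caputoFirstIntervalSol α y₀ b =
      fun t => y₀ + ∑' k : ℕ, caputoCoeff α b k * t ^ (((k : ℝ) + 1) * α) := by
  funext t
  simp only [caputoFirstIntervalSol, caputoCoeff]
  congr 1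
  exact tsum_congr fun k => by ring

theorem hasDerivAt_caputoFirstIntervalSol (y₀ : ℝ) (hα0 : 0 < α) (hα1 : α < 1)
    (hb : ∀ r : ℝ, 0 ≤ r → Summable (fun k : ℕ => |b k| * r ^ k)) {t : ℝ} (ht : 0 < t) :
    HasDerivAt (caputoFirstIntervalSol α y₀ b)
      (∑' k : ℕ, caputoCoeff α b k * ((((k : ℝ) + 1) * α) * t ^ (((k : ℝ) + 1) * α - 1))) t := by
  rw [caputoFirstIntervalSol_eq]
  refine HasDerivAt.const_add _ ?_
  have hmem : t ∈ Set.Ioo (t / 2) (2 * t) := ⟨by linarith, by linarith⟩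
  refine hasDerivAt_tsum_of_isPreconnected
    (((summable_abs_caputoCoeff hα0 hα1 hb (Real.rpow_nonneg (mul_pos two_pos ht).le α)).mul_left
      (α * (t / 2) ^ (α - 1)))) isOpen_Ioo isPreconnected_Ioo
    (fun k x hx => (Real.hasDerivAt_rpow_const (Or.inl ?_)).const_mul _) (fun k x hx => ?_) hmem
    (summable_caputoCoeff_mul_rpow hα0 hα1 hb ht.le) hmem
  · linarith [hx.1]
  · have hx0 : 0 < x := by linarith [hx.1]
    have h := rpow_natCast_add_one_mul (α := α) hx0 k (-1)
    simp only [← sub_eq_add_neg] at h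
    rw [h, norm_mul, Real.norm_eq_abs, Real.norm_of_nonneg (by positivity)]
    have hl : x ^ (α - 1) ≤ (t / 2) ^ (α - 1) :=
      Real.rpow_le_rpow_of_nonpos (by linarith) hx.1.le (by linarith)
    have hu : x ^ α ≤ (2 * t) ^ α := Real.rpow_le_rpow hx0.le hx.2.le hα0.le
    calc _ ≤ |caputoCoeff α b k| *
          (((k : ℝ) + 1) * α * ((t / 2) ^ (α - 1) * ((2 * t) ^ α) ^ k)) := by gcongr
      _ = _ := by ring

theorem caputoCoeff_mul_beta (hα0 : 0 < α) {t : ℝ} (ht : 0 < t) (k : ℕ) :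
    caputoCoeff α b k * (((k : ℝ) + 1) * α) * (t ^ (((k : ℝ) + 1) * α + (1 - α) - 1) *
      (Real.Gamma (((k : ℝ) + 1) * α) * Real.Gamma (1 - α) /
        Real.Gamma (((k : ℝ) + 1) * α + (1 - α)))) =
      Real.Gamma (1 - α) * (b k * (t ^ α / α) ^ k) := by
  have hp : 0 < ((k : ℝ) + 1) * α := by positivity
  have h1 : 0 < Real.Gamma (α * (k : ℝ) + 1) := Real.Gamma_pos_of_pos (by positivity)
  have h2 := Real.Gamma_pos_of_pos hp
  rw [show ((k : ℝ) + 1) * α + (1 - α) = α * k + 1 by ring, add_sub_cancel_right,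
    Real.rpow_mul ht.le, Real.rpow_natCast, caputoCoeff, Real.Gamma_add_one hp.ne', div_pow]
  field_simp

theorem integral_sub_rpow_mul_deriv_caputoFirstIntervalSol (y₀ : ℝ) (hα0 : 0 < α) (hα1 : α < 1)
    (hb : ∀ r : ℝ, 0 ≤ r → Summable (fun k : ℕ => |b k| * r ^ k)) {t : ℝ} (ht : 0 < t) :
    ∫ τ in (0 : ℝ)..t, (t - τ) ^ (-α) * deriv (caputoFirstIntervalSol α y₀ b) τ
      = Real.Gamma (1 - α) * ∑' k : ℕ, b k * (t ^ α / α) ^ k := by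
  set e : ℕ → ℝ := fun k => caputoCoeff α b k * (((k : ℝ) + 1) * α)
  set B : ℕ → ℝ → ℝ := fun k τ => (t - τ) ^ (1 - α - 1) * τ ^ (((k : ℝ) + 1) * α - 1)
  have hp : ∀ k : ℕ, 0 < ((k : ℝ) + 1) * α := fun k => by positivity
  have hα : 0 < 1 - α := by linarith
  have hB : ∀ k, ∫ τ in Set.Ioc 0 t, B k τ = t ^ (((k : ℝ) + 1) * α + (1 - α) - 1) *
      (Real.Gamma (((k : ℝ) + 1) * α) * Real.Gamma (1 - α) /
        Real.Gamma (((k : ℝ) + 1) * α + (1 - α))) := fun k => by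
    rw [← integral_sub_rpow_mul_rpow (hp k) hα ht, intervalIntegral.integral_of_le ht.le]
  have hBint : ∀ k, MeasureTheory.IntegrableOn (B k) (Set.Ioc 0 t) := fun k =>
    (intervalIntegrable_iff_integrableOn_Ioc_of_le ht.le).mp
      (intervalIntegrable_sub_rpow_mul_rpow (hp k) hα ht)
  have hnorm : ∀ k, ∫ τ in Set.Ioc 0 t, ‖e k * B k τ‖ =
      Real.Gamma (1 - α) * (|b k| * (t ^ α / α) ^ k) := fun k => by
    have hcongr : ∀ τ ∈ Set.Ioc (0 : ℝ) t, ‖e k * B k τ‖ = |e k| * B k τ := fun τ hτ => by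
      rw [norm_mul, Real.norm_eq_abs, Real.norm_of_nonneg]
      exact mul_nonneg (Real.rpow_nonneg (sub_nonneg.mpr hτ.2) _) (Real.rpow_nonneg hτ.1.le _)
    have h1 := Real.Gamma_pos_of_pos (hp k)
    have h2 := Real.Gamma_pos_of_pos hα
    have h3 := Real.Gamma_pos_of_pos (add_pos (hp k) hα)
    have hβ : 0 ≤ ∫ τ in Set.Ioc 0 t, B k τ := by
      rw [hB]
      positivity
    calc _ = |e k| * ∫ τ in Set.Ioc 0 t, B k τ := by
          rw [MeasureTheory.setIntegral_congr_fun measurableSet_Ioc hcongr,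
            MeasureTheory.integral_const_mul]
      _ = |Real.Gamma (1 - α) * (b k * (t ^ α / α) ^ k)| := by
          rw [← caputoCoeff_mul_beta hα0 ht k, ← hB, abs_mul _ (∫ _ in _, _), abs_of_nonneg hβ]
      _ = _ := by
          rw [abs_mul, abs_mul, abs_of_pos h2, abs_of_nonneg (by positivity : 0 ≤ (t ^ α / α) ^ k)]
  have hsum := MeasureTheory.hasSum_integral_of_summable_integral_norm
    (fun k => (hBint k).const_mul (e k))
    (by simpa only [hnorm] using (hb (t ^ α / α) (by positivity)).mul_left (Real.Gamma (1 - α)))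
  rw [intervalIntegral.integral_of_le ht.le, ← tsum_mul_left]
  simp only [← caputoCoeff_mul_beta hα0 ht, ← hB]
  simp only [MeasureTheory.integral_const_mul] at hsum
  refine Eq.trans ?_ hsum.tsum_eq.symm
  refine MeasureTheory.setIntegral_congr_fun measurableSet_Ioc fun τ hτ => ?_
  simp only [(hasDerivAt_caputoFirstIntervalSol y₀ hα0 hα1 hb hτ.1).deriv, ← tsum_mul_left, e, B]
  refine tsum_congr fun k => ?_
  rw [sub_sub_cancel_left]
  ring

end

/-- On `[0,T)` the series `y(t) = y₀ + ∑_k (Γ(αk+1)/α^k) b_k t^((k+1)α)/Γ((k+1)α+1)`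
converges, satisfies `y(0) = y₀`, its Caputo derivative equals the forcing
`b(t) = ∑_k b_k (t^α/α)^k` for every `t > 0`, and (since the delayed term vanishes
there) it solves the Caputo delay equation `^C D^α y(t) + a y(t-T) = b(t)` on `(0,T)`
with `y ≡ 0` on `(-∞,0)`. -/
theorem caputo_first_interval_solution
    (α a y₀ T : ℝ) (b : ℕ → ℝ) (hα0 : 0 < α) (hα1 : α < 1) (hT : 0 < T)
    (hb : ∀ r : ℝ, 0 ≤ r → Summable (fun k : ℕ => |b k| * r ^ k)) :
    (∀ t : ℝ, 0 ≤ t → Summable (fun k : ℕ =>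
        (Real.Gamma (α * (k : ℝ) + 1) / α ^ k) * b k
          * t ^ (((k : ℝ) + 1) * α) / Real.Gamma (((k : ℝ) + 1) * α + 1)))
    ∧ caputoFirstIntervalSol α y₀ b 0 = y₀
    ∧ (∀ t : ℝ, 0 < t →
        (1 / Real.Gamma (1 - α)) *
            ∫ τ in (0 : ℝ)..t, (t - τ) ^ (-α) * deriv (caputoFirstIntervalSol α y₀ b) τ
          = ∑' k : ℕ, b k * (t ^ α / α) ^ k)
    ∧ ∀ t ∈ Set.Ioo (0 : ℝ) T,
        (1 / Real.Gamma (1 - α)) *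
            (∫ τ in (0 : ℝ)..t, (t - τ) ^ (-α) * deriv (caputoFirstIntervalSol α y₀ b) τ)
          + a * (if t - T < 0 then 0 else caputoFirstIntervalSol α y₀ b (t - T))
          = ∑' k : ℕ, b k * (t ^ α / α) ^ k := by
  have hcaputo : ∀ t : ℝ, 0 < t →
      (1 / Real.Gamma (1 - α)) *
          ∫ τ in (0 : ℝ)..t, (t - τ) ^ (-α) * deriv (caputoFirstIntervalSol α y₀ b) τ
        = ∑' k : ℕ, b k * (t ^ α / α) ^ k := fun t ht => by
    have hG : Real.Gamma (1 - α) ≠ 0 := (Real.Gamma_pos_of_pos (by linarith)).ne'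
    rw [integral_sub_rpow_mul_deriv_caputoFirstIntervalSol y₀ hα0 hα1 hb ht, ← mul_assoc,
      one_div_mul_cancel hG, one_mul]
  refine ⟨fun t ht => ?_, ?_, hcaputo, fun t ht => ?_⟩
  · refine (summable_caputoCoeff_mul_rpow hα0 hα1 hb ht).congr fun k => ?_
    rw [caputoCoeff]
    ring
  · have hzero : ∀ k : ℕ, (0 : ℝ) ^ (((k : ℝ) + 1) * α) = 0 := fun k =>
      Real.zero_rpow (by positivity)
    simp [caputoFirstIntervalSol_eq, hzero]
  · rw [if_pos (by linarith [ht.2]), mul_zero, add_zero, hcaputo t ht.1]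
end

section
/- Let α ∈ (0,1), a, y₀ ∈ ℝ, T > 0, and let (b_k)_{k≥0} be real coefficients such that the power series ∑_{k=0}^∞ b_k z^k has infinite radius of convergence, with forcing b(t) := ∑_{k=0}^∞ b_k (t^α/α)^k. Define y : ℝ → ℝ by y(t) = 0 for t < 0 and, for t ≥ 0, y(t) = ∑_{j=0}^{⌊t/T⌋} (−a)^j [ y₀ (t − jT)^{αj}/Γ(αj+1) + ∑_{k=0}^∞ (Γ(αk+1)/α^k) b_k (t − jT)^{(j+k+1)α}/Γ((j+k+1)α+1) ]. Then y(0) = y₀, the inner series converges for every t, and for every t > 0 that is not an integer multiple of T, y satisfies the Caputo fractional-delay equation (1/Γ(1−α)) ∫₀^t (t−τ)^{−α} y′(τ) dτ + a · y(t − T) = b(t). -/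
open Filter Topology intervalIntegral
open MeasureTheory

/-- The generalized power series `∑ₖ cₖ s^((j+k)α) / Γ((j+k)α + 1)`. -/
noncomputable def fracSeries (α : ℝ) (c : ℕ → ℝ) (j : ℕ) (s : ℝ) : ℝ :=
  ∑' k : ℕ, c k * s ^ (((j : ℝ) + k) * α) / Real.Gamma (((j : ℝ) + k) * α + 1)

/-- `fracSeries`, extended by zero to the negative half-line. -/
noncomputable def causalSeries (α : ℝ) (c : ℕ → ℝ) (j : ℕ) (s : ℝ) : ℝ :=
  if 0 ≤ s then fracSeries α c j s else 0

/-- The termwise derivative of `fracSeries` on `s > 0`, extended by zero. -/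
noncomputable def causalDeriv (α : ℝ) (c : ℕ → ℝ) (j : ℕ) (s : ℝ) : ℝ :=
  if 0 < s then ∑' k : ℕ, c k * s ^ (((j : ℝ) + k) * α - 1) / Real.Gamma (((j : ℝ) + k) * α) else 0

lemma Real.exists_Gamma_le_mul_Gamma_add :
    ∃ C : ℝ, 0 ≤ C ∧ ∀ x v : ℝ, 1 ≤ x → 0 ≤ v → Real.Gamma x ≤ C * Real.Gamma (x + v) := by
  obtain ⟨m, hm, hmin⟩ := Real.exists_isMinOn_Gamma_Ioi
  have hm0 : 0 < Real.Gamma m := Real.Gamma_pos_of_pos (by linarith [hm.1])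
  refine ⟨1 + 1 / Real.Gamma m, by positivity, fun x v hx hv => ?_⟩
  have hpos : 0 < Real.Gamma (x + v) := Real.Gamma_pos_of_pos (by linarith)
  rcases le_total 2 x with h | h
  · have h1 : Real.Gamma x ≤ Real.Gamma (x + v) :=
      Real.Gamma_strictMonoOn_Ici.monotoneOn h (by simp; linarith) (by linarith)
    have h2 : 0 ≤ 1 / Real.Gamma m * Real.Gamma (x + v) := by positivity
    linarith
  · have h1 : Real.Gamma x ≤ 1 := by
      have := Real.convexOn_Gamma.2 (show (1 : ℝ) ∈ Set.Ioi 0 by simp)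
        (show (2 : ℝ) ∈ Set.Ioi 0 by simp) (show 0 ≤ 2 - x by linarith)
        (show 0 ≤ x - 1 by linarith) (by ring)
      simp only [smul_eq_mul, Real.Gamma_one, Real.Gamma_two] at this
      have e : (2 - x) * 1 + (x - 1) * 2 = x := by ring
      rw [e] at this
      linarith
    have h2 : Real.Gamma m ≤ Real.Gamma (x + v) := hmin (by simp; linarith)
    have h3 : 1 ≤ 1 / Real.Gamma m * Real.Gamma (x + v) := by
      rw [one_div, inv_mul_eq_div, one_le_div hm0]; exact h2
    linarith

lemma summable_weight_mul_fracSeries {α : ℝ} (hα0 : 0 < α) {c : ℕ → ℝ}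
    (hc : ∀ r : ℝ, 0 ≤ r → Summable fun k : ℕ => |c k| * r ^ k / Real.Gamma (α * k + 1))
    (j : ℕ) {p : ℕ → ℝ} {D : ℝ} (hp0 : ∀ k, 0 ≤ p k) (hp : ∀ k, p k ≤ D * 2 ^ k)
    {r : ℝ} (hr : 0 ≤ r) :
    Summable fun k : ℕ => p k *
      (|c k| * r ^ (((j : ℝ) + k) * α) / Real.Gamma (((j : ℝ) + k) * α + 1)) := by
  obtain ⟨C, hC0, hC⟩ := Real.exists_Gamma_le_mul_Gamma_add
  have hD : 0 ≤ D := by simpa using (hp0 0).trans (hp 0)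
  refine Summable.of_nonneg_of_le (fun k => ?_) (fun k => ?_)
    ((hc (2 * r ^ α) (by positivity)).mul_left (D * C * r ^ ((j : ℝ) * α)))
  · have := Real.Gamma_pos_of_pos (show 0 < ((j : ℝ) + k) * α + 1 by positivity)
    have := hp0 k
    positivity
  · have g1 := Real.Gamma_pos_of_pos (show 0 < ((j : ℝ) + k) * α + 1 by positivity)
    have g2 := Real.Gamma_pos_of_pos (show 0 < α * k + 1 by positivity)
    have hG := hC (α * k + 1) (j * α) (by nlinarith [show 0 ≤ α * k by positivity]) (by positivity)
    rw [show α * k + 1 + j * α = ((j : ℝ) + k) * α + 1 by ring] at hG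
    have e : r ^ (((j : ℝ) + k) * α) = r ^ ((j : ℝ) * α) * (r ^ α) ^ k := by
      rw [add_mul, Real.rpow_add_of_nonneg hr (by positivity) (by positivity), mul_comm (k : ℝ),
        Real.rpow_mul_natCast hr]
    have hinv : 1 / Real.Gamma (((j : ℝ) + k) * α + 1) ≤ C / Real.Gamma (α * k + 1) := by
      rw [div_le_div_iff₀ g1 g2]; linarith
    calc _ = p k * (|c k| * (r ^ ((j : ℝ) * α) * (r ^ α) ^ k)
            * (1 / Real.Gamma (((j : ℝ) + k) * α + 1))) := by rw [e]; ring
      _ ≤ (D * 2 ^ k) * (|c k| * (r ^ ((j : ℝ) * α) * (r ^ α) ^ k)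
            * (C / Real.Gamma (α * k + 1))) := by
          gcongr
          exact hp k
      _ = _ := by rw [mul_pow]; ring

lemma summable_abs_fracSeries {α : ℝ} (hα0 : 0 < α) {c : ℕ → ℝ}
    (hc : ∀ r : ℝ, 0 ≤ r → Summable fun k : ℕ => |c k| * r ^ k / Real.Gamma (α * k + 1))
    (j : ℕ) {r : ℝ} (hr : 0 ≤ r) :
    Summable fun k : ℕ =>
      |c k| * r ^ (((j : ℝ) + k) * α) / Real.Gamma (((j : ℝ) + k) * α + 1) := by
  simpa using summable_weight_mul_fracSeries hα0 hc j (p := fun _ => 1) (D := 1)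
    (fun _ => zero_le_one) (fun k => by simpa using one_le_pow₀ (one_le_two)) hr

lemma summable_fracSeries {α : ℝ} (hα0 : 0 < α) {c : ℕ → ℝ}
    (hc : ∀ r : ℝ, 0 ≤ r → Summable fun k : ℕ => |c k| * r ^ k / Real.Gamma (α * k + 1))
    (j : ℕ) (s : ℝ) :
    Summable fun k : ℕ =>
      c k * s ^ (((j : ℝ) + k) * α) / Real.Gamma (((j : ℝ) + k) * α + 1) := by
  refine Summable.of_norm_bounded (summable_abs_fracSeries hα0 hc j (abs_nonneg s)) fun k => ?_
  have g1 := Real.Gamma_pos_of_pos (show 0 < ((j : ℝ) + k) * α + 1 by positivity)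
  rw [Real.norm_eq_abs, abs_div, abs_mul, abs_of_pos g1]
  gcongr
  exact Real.abs_rpow_le_abs_rpow _ _

lemma Real.inv_Gamma_eq_mul_inv_Gamma_add_one (x : ℝ) :
    (Real.Gamma x)⁻¹ = x * (Real.Gamma (x + 1))⁻¹ := by
  rcases eq_or_ne x 0 with rfl | hx
  · simp
  · rw [Real.Gamma_add_one hx, mul_inv, mul_inv_cancel_left₀ hx]

lemma hasDerivAt_fracSeries {α : ℝ} (hα0 : 0 < α) {c : ℕ → ℝ}
    (hc : ∀ r : ℝ, 0 ≤ r → Summable fun k : ℕ => |c k| * r ^ k / Real.Gamma (α * k + 1))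
    (j : ℕ) {s : ℝ} (hs : 0 < s) :
    HasDerivAt (fracSeries α c j) (causalDeriv α c j s) s := by
  rw [causalDeriv, if_pos hs]
  have hsum := (summable_weight_mul_fracSeries hα0 hc j (p := fun k => ((j : ℝ) + k) * α)
    (D := ((j : ℝ) + 1) * α) (fun _ => by positivity) (fun k => by
      have h1 : (1 : ℝ) ≤ 2 ^ k := one_le_pow₀ one_le_two
      have h2 : (k : ℝ) ≤ 2 ^ k := by exact_mod_cast Nat.lt_two_pow_self.le
      have h3 : (j : ℝ) + k ≤ (j + 1) * 2 ^ k := by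
        nlinarith [show (0 : ℝ) ≤ j by positivity]
      nlinarith) (r := 2 * s) (by positivity)).mul_left (2 / s)
  refine hasDerivAt_tsum_of_isPreconnected (t := Set.Ioo (s / 2) (2 * s)) (y₀ := s)
    (g := fun (k : ℕ) (x : ℝ) => c k * x ^ (((j : ℝ) + k) * α) / Real.Gamma (((j : ℝ) + k) * α + 1))
    (g' := fun (k : ℕ) (x : ℝ) =>
      c k * x ^ (((j : ℝ) + k) * α - 1) / Real.Gamma (((j : ℝ) + k) * α)) hsum
    isOpen_Ioo isPreconnected_Ioo (fun k x hx => ?_) (fun k x hx => ?_)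
    ⟨by linarith, by linarith⟩ (summable_fracSeries hα0 hc j s) ⟨by linarith, by linarith⟩
  · have hx0 : 0 < x := by linarith [hx.1]
    have := ((Real.hasDerivAt_rpow_const (x := x) (p := ((j : ℝ) + k) * α)
      (Or.inl hx0.ne')).const_mul (c k)).div_const (Real.Gamma (((j : ℝ) + k) * α + 1))
    refine this.congr_deriv ?_
    symm
    rw [div_eq_mul_inv, Real.inv_Gamma_eq_mul_inv_Gamma_add_one]
    ring
  · have hx0 : 0 < x := by linarith [hx.1]
    have g1 := Real.Gamma_pos_of_pos (show 0 < ((j : ℝ) + k) * α + 1 by positivity)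
    rw [div_eq_mul_inv, Real.inv_Gamma_eq_mul_inv_Gamma_add_one, Real.rpow_sub_one hx0.ne',
      Real.norm_eq_abs, abs_mul, abs_mul, abs_of_nonneg
        (show 0 ≤ x ^ (((j : ℝ) + k) * α) / x by positivity), abs_of_nonneg
        (show 0 ≤ ((j : ℝ) + k) * α * (Real.Gamma (((j : ℝ) + k) * α + 1))⁻¹ by positivity)]
    have h1 : x ^ (((j : ℝ) + k) * α) / x ≤ (2 * s) ^ (((j : ℝ) + k) * α) * (2 / s) := by
      rw [div_eq_mul_inv]
      gcongr
      · exact hx.2.le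
      · rw [inv_le_comm₀ hx0 (by positivity), inv_div]; exact hx.1.le
    calc _ ≤ |c k| * ((2 * s) ^ (((j : ℝ) + k) * α) * (2 / s)) *
          (((j : ℝ) + k) * α * (Real.Gamma (((j : ℝ) + k) * α + 1))⁻¹) := by gcongr
      _ = _ := by ring

lemma hasDerivAt_causalSeries {α : ℝ} (hα0 : 0 < α) {c : ℕ → ℝ}
    (hc : ∀ r : ℝ, 0 ≤ r → Summable fun k : ℕ => |c k| * r ^ k / Real.Gamma (α * k + 1))
    (j : ℕ) {s : ℝ} (hs : s ≠ 0) :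
    HasDerivAt (causalSeries α c j) (causalDeriv α c j s) s := by
  rcases hs.lt_or_gt with h | h
  · rw [causalDeriv, if_neg h.not_gt]
    refine (hasDerivAt_const s (0 : ℝ)).congr_of_eventuallyEq ?_
    filter_upwards [Iio_mem_nhds h] with x hx
    exact if_neg (not_le.2 hx)
  · refine (hasDerivAt_fracSeries hα0 hc j h).congr_of_eventuallyEq ?_
    filter_upwards [Ioi_mem_nhds h] with x hx
    exact if_pos (le_of_lt hx)

lemma Real.integral_rpow_mul_rpow_sub {u v s : ℝ} (hu : 0 < u) (hv : 0 < v) (hs : 0 < s) :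
    ∫ x in (0 : ℝ)..s, (s - x) ^ (v - 1) * x ^ (u - 1)
      = s ^ (u + v - 1) * (Real.Gamma u * Real.Gamma v / Real.Gamma (u + v)) := by
  have h := Complex.betaIntegral_scaled (u : ℂ) (v : ℂ) hs
  have hB := Complex.Gamma_mul_Gamma_eq_betaIntegral (s := (u : ℂ)) (t := (v : ℂ))
    (by simpa) (by simpa)
  have hG : Complex.Gamma ((u : ℂ) + v) ≠ 0 := by
    rw [← Complex.ofReal_add, Complex.Gamma_ofReal]
    exact_mod_cast (Real.Gamma_pos_of_pos (by linarith)).ne'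
  have hB' : Complex.betaIntegral u v
      = ((Real.Gamma u * Real.Gamma v / Real.Gamma (u + v) : ℝ) : ℂ) := by
    push_cast [← Complex.Gamma_ofReal]
    rw [hB, mul_div_cancel_left₀ _ hG]
  have hL : ∫ x in (0 : ℝ)..s, (x : ℂ) ^ ((u : ℂ) - 1) * ((s : ℂ) - x) ^ ((v : ℂ) - 1)
      = ((∫ x in (0 : ℝ)..s, (s - x) ^ (v - 1) * x ^ (u - 1) : ℝ) : ℂ) := by
    rw [← intervalIntegral.integral_ofReal]
    refine intervalIntegral.integral_congr fun x hx => ?_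
    rw [Set.uIcc_of_le hs.le] at hx
    push_cast [Complex.ofReal_cpow hx.1, Complex.ofReal_cpow (sub_nonneg.2 hx.2)]
    ring
  rw [hL, hB'] at h
  have e : (s : ℂ) ^ ((u : ℂ) + v - 1) = ((s ^ (u + v - 1) : ℝ) : ℂ) := by
    push_cast [Complex.ofReal_cpow hs.le]; rfl
  rw [e] at h
  exact_mod_cast h

lemma MeasureTheory.integrable_tsum_of_summable_integral_norm {X : Type*} {_ : MeasurableSpace X}
    {μ : Measure X} {F : ℕ → X → ℝ} (hF : ∀ i, Integrable (F i) μ)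
    (hsum : Summable fun i => ∫ x, ‖F i x‖ ∂μ) : Integrable (fun x => ∑' i, F i x) μ := by
  have hfin : ∑' i, ∫⁻ x, ‖F i x‖ₑ ∂μ ≠ ⊤ := by
    have (i : ℕ) : ∫⁻ x, ‖F i x‖ₑ ∂μ = ENNReal.ofReal (∫ x, ‖F i x‖ ∂μ) :=
      (ofReal_integral_norm_eq_lintegral_enorm (hF i)).symm
    simp_rw [this]
    exact hsum.tsum_ofReal_ne_top
  have hae := summable_norm_of_tsum_eLpNorm_ne_top (p := 1) le_rfl (fun i => (hF i).1)
    (by simpa [eLpNorm_one_eq_lintegral_enorm] using hfin)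
  refine ⟨aestronglyMeasurable_of_tendsto_ae atTop
    (f := fun n x => ∑ i ∈ Finset.range n, F i x)
    (fun n => Finset.aestronglyMeasurable_fun_sum _ fun i _ => (hF i).1) ?_, ?_⟩
  · filter_upwards [hae] with x hx
    exact hx.of_norm.hasSum.tendsto_sum_nat
  · rw [hasFiniteIntegral_iff_enorm]
    refine (lintegral_mono fun x => enorm_tsum_le_tsum_enorm).trans_lt ?_
    rw [lintegral_tsum fun i => (hF i).1.enorm]
    exact hfin.lt_top

lemma Real.intervalIntegrable_rpow_mul_rpow_sub {u v s : ℝ} (hu : 0 < u) (hv : 0 < v)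
    (hs : 0 < s) :
    IntervalIntegrable (fun x => (s - x) ^ (v - 1) * x ^ (u - 1)) volume 0 s := by
  by_contra h
  have h0 := intervalIntegral.integral_undef h
  rw [Real.integral_rpow_mul_rpow_sub hu hv hs] at h0
  have := Real.Gamma_pos_of_pos hu
  have := Real.Gamma_pos_of_pos hv
  have := Real.Gamma_pos_of_pos (add_pos hu hv)
  exact absurd h0 (by positivity)

lemma integral_kernel_mul_causalDeriv {α : ℝ} (hα0 : 0 < α) (hα1 : α < 1) {c : ℕ → ℝ}
    (hc : ∀ r : ℝ, 0 ≤ r → Summable fun k : ℕ => |c k| * r ^ k / Real.Gamma (α * k + 1))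
    (j : ℕ) {s : ℝ} (hs : 0 < s) :
    IntervalIntegrable (fun x => (s - x) ^ (-α) * causalDeriv α c (j + 1) x) volume 0 s ∧
    ∫ x in (0 : ℝ)..s, (s - x) ^ (-α) * causalDeriv α c (j + 1) x
      = Real.Gamma (1 - α) * fracSeries α c j s := by
  set β : ℕ → ℝ := fun k => (((j + 1 : ℕ) : ℝ) + k) * α with hβ
  have hβ0 : ∀ k, 0 < β k := fun k => by positivity
  have hg := Real.Gamma_pos_of_pos (show 0 < 1 - α by linarith)
  have hβ1 : ∀ k, β k + (1 - α) = ((j : ℝ) + k) * α + 1 := fun k => by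
    simp only [hβ]; push_cast; ring
  set F : ℕ → ℝ → ℝ := fun k x =>
    c k / Real.Gamma (β k) * ((s - x) ^ (1 - α - 1) * x ^ (β k - 1)) with hF
  have hint : ∀ k, IntegrableOn (F k) (Set.Ioc 0 s) := fun k =>
    ((intervalIntegrable_iff_integrableOn_Ioc_of_le hs.le).1
      (Real.intervalIntegrable_rpow_mul_rpow_sub (hβ0 k) (show 0 < 1 - α by linarith) hs)).const_mul _
  have hval : ∀ k, ∫ x in Set.Ioc 0 s, (s - x) ^ (1 - α - 1) * x ^ (β k - 1)
      = s ^ (((j : ℝ) + k) * α) * (Real.Gamma (β k) * Real.Gamma (1 - α)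
          / Real.Gamma (((j : ℝ) + k) * α + 1)) := fun k => by
    rw [← intervalIntegral.integral_of_le hs.le,
      Real.integral_rpow_mul_rpow_sub (hβ0 k) (show 0 < 1 - α by linarith) hs, hβ1,
      add_sub_cancel_right]
  have hsum : Summable fun k => ∫ x in Set.Ioc 0 s, ‖F k x‖ := by
    refine ((summable_abs_fracSeries hα0 hc j hs.le).mul_left (Real.Gamma (1 - α))).congr
      fun k => ?_
    have g := Real.Gamma_pos_of_pos (hβ0 k)
    have e : ∫ x in Set.Ioc 0 s, ‖F k x‖
        = ∫ x in Set.Ioc 0 s, |c k| / Real.Gamma (β k) *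
            ((s - x) ^ (1 - α - 1) * x ^ (β k - 1)) := by
      refine setIntegral_congr_fun measurableSet_Ioc fun x hx => ?_
      have h1 : 0 ≤ (s - x) ^ (1 - α - 1) := Real.rpow_nonneg (sub_nonneg.2 hx.2) _
      have h2 : 0 ≤ x ^ (β k - 1) := Real.rpow_nonneg hx.1.le _
      simp only [hF]
      rw [Real.norm_eq_abs, abs_mul, abs_div, abs_of_pos g, abs_of_nonneg (mul_nonneg h1 h2)]
    rw [e, MeasureTheory.integral_const_mul, hval]
    field_simp
  have hEq : Set.EqOn (fun x => (s - x) ^ (-α) * causalDeriv α c (j + 1) x)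
      (fun x => ∑' k, F k x) (Set.Ioc 0 s) := fun x hx => by
    simp only [causalDeriv, if_pos hx.1, hF]
    rw [← tsum_mul_left]
    refine tsum_congr fun k => ?_
    rw [show 1 - α - 1 = -α by ring]
    ring
  constructor
  · rw [intervalIntegrable_iff_integrableOn_Ioc_of_le hs.le,
      integrableOn_congr_fun hEq measurableSet_Ioc]
    exact integrable_tsum_of_summable_integral_norm hint hsum
  · rw [intervalIntegral.integral_of_le hs.le, setIntegral_congr_fun measurableSet_Ioc hEq,
      ← (hasSum_integral_of_summable_integral_norm hint hsum).tsum_eq, fracSeries, ← tsum_mul_left]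
    refine tsum_congr fun k => ?_
    have g := Real.Gamma_pos_of_pos (hβ0 k)
    simp only [hF]
    rw [MeasureTheory.integral_const_mul, hval]
    field_simp

lemma integral_kernel_mul_causalDeriv_comp_sub {α : ℝ} (hα0 : 0 < α) (hα1 : α < 1) {c : ℕ → ℝ}
    (hc : ∀ r : ℝ, 0 ≤ r → Summable fun k : ℕ => |c k| * r ^ k / Real.Gamma (α * k + 1))
    (j : ℕ) {t u : ℝ} (ht : 0 < t) (hu : 0 ≤ u) (htu : t ≠ u) :
    IntervalIntegrable (fun x => (t - x) ^ (-α) * causalDeriv α c (j + 1) (x - u)) volume 0 t ∧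
    ∫ x in (0 : ℝ)..t, (t - x) ^ (-α) * causalDeriv α c (j + 1) (x - u)
      = Real.Gamma (1 - α) * causalSeries α c j (t - u) := by
  have hzero : ∀ w, 0 ≤ w → w ≤ u →
      Set.EqOn (fun x => (t - x) ^ (-α) * causalDeriv α c (j + 1) (x - u)) (fun _ => 0)
        (Set.uIcc 0 w) := fun w hw hwu x hx => by
    rw [Set.uIcc_of_le hw] at hx
    simp only [causalDeriv]
    rw [if_neg (by linarith [hx.2]), mul_zero]
  have hzi : ∀ w, 0 ≤ w → w ≤ u →
      IntervalIntegrable (fun x => (t - x) ^ (-α) * causalDeriv α c (j + 1) (x - u))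
        volume 0 w := fun w hw hwu =>
    (intervalIntegrable_const (c := (0 : ℝ))).congr
      fun x hx => ((hzero w hw hwu) (Set.uIoc_subset_uIcc hx)).symm
  rcases htu.lt_or_gt with h | h
  · refine ⟨hzi t ht.le h.le, ?_⟩
    rw [intervalIntegral.integral_congr (hzero t ht.le h.le), causalSeries, if_neg (by linarith)]
    simp
  · have hs : 0 < t - u := sub_pos.2 h
    obtain ⟨h1, h2⟩ := integral_kernel_mul_causalDeriv hα0 hα1 hc j hs
    have hshift : (fun x => (t - x) ^ (-α) * causalDeriv α c (j + 1) (x - u))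
        = fun x => (fun z => (t - u - z) ^ (-α) * causalDeriv α c (j + 1) z) (x - u) := by
      funext x
      simp only [sub_sub_sub_cancel_right]
    have hi : IntervalIntegrable (fun x => (t - x) ^ (-α) * causalDeriv α c (j + 1) (x - u))
        volume u t := by
      rw [hshift]
      simpa using h1.comp_sub_right u
    refine ⟨(hzi u hu le_rfl).trans hi, ?_⟩
    rw [← intervalIntegral.integral_add_adjacent_intervals (hzi u hu le_rfl) hi,
      intervalIntegral.integral_congr (hzero u hu le_rfl), hshift,
      intervalIntegral.integral_comp_sub_right (fun z => (t - u - z) ^ (-α) *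
        causalDeriv α c (j + 1) z), sub_self, h2, causalSeries, if_pos hs.le]
    simp

/-- The sequence `x, c 0, c 1, …`. -/
def consSeq (x : ℝ) (c : ℕ → ℝ) : ℕ → ℝ
  | 0 => x
  | k + 1 => c k

lemma summable_consSeq {α : ℝ} (hα0 : 0 < α) (x : ℝ) {c : ℕ → ℝ}
    (hc : ∀ r : ℝ, 0 ≤ r → Summable fun k : ℕ => |c k| * r ^ k / Real.Gamma (α * k + 1))
    (r : ℝ) (hr : 0 ≤ r) :
    Summable fun k : ℕ => |consSeq x c k| * r ^ k / Real.Gamma (α * k + 1) := by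
  rw [← summable_nat_add_iff 1]
  refine ((summable_abs_fracSeries hα0 hc 1 (r := r ^ α⁻¹) (by positivity))).congr fun k => ?_
  rw [← Real.rpow_mul hr, show α⁻¹ * (((1 : ℕ) + (k : ℝ)) * α) = ((k + 1 : ℕ) : ℝ) by
    push_cast; field_simp; ring, Real.rpow_natCast]
  simp only [consSeq]
  congr 3
  push_cast
  ring

lemma fracSeries_consSeq {α : ℝ} (hα0 : 0 < α) (x : ℝ) {c : ℕ → ℝ}
    (hc : ∀ r : ℝ, 0 ≤ r → Summable fun k : ℕ => |c k| * r ^ k / Real.Gamma (α * k + 1))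
    (j : ℕ) (s : ℝ) :
    fracSeries α (consSeq x c) j s
      = x * s ^ ((j : ℝ) * α) / Real.Gamma (j * α + 1) + fracSeries α c (j + 1) s := by
  rw [fracSeries, (summable_fracSeries hα0 (summable_consSeq hα0 x hc) j s).tsum_eq_zero_add,
    fracSeries]
  congr 1
  · simp [consSeq]
  · refine tsum_congr fun k => ?_
    simp only [consSeq]
    push_cast
    rw [show (j : ℝ) + (k + 1) = j + 1 + k by ring]

lemma causalDeriv_consSeq_zero {α : ℝ} (hα0 : 0 < α) (x : ℝ) {c : ℕ → ℝ}
    (hc : ∀ r : ℝ, 0 ≤ r → Summable fun k : ℕ => |c k| * r ^ k / Real.Gamma (α * k + 1)) :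
    causalDeriv α (consSeq x c) 0 = causalDeriv α c 1 := by
  funext s
  rcases lt_trichotomy s 0 with h | h | h
  · simp [causalDeriv, h.not_gt]
  · simp [causalDeriv, h]
  · have h1 := hasDerivAt_fracSeries hα0 (summable_consSeq hα0 x hc) 0 h
    have h2 := hasDerivAt_fracSeries hα0 hc 1 h
    have e : fracSeries α (consSeq x c) 0 = fun s => x + fracSeries α c 1 s := by
      funext z
      simp [fracSeries_consSeq hα0 x hc]
    rw [e] at h1
    exact h1.unique (h2.const_add x)

/-- Series solution of the Caputo fractional-delay equation with analytic forcing
`b(t) = ∑_k b_k (t^α/α)^k` (power series of infinite radius of convergence):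
the explicit double series `y` satisfies `y(0) = y₀`, its inner series converges for
every `t`, and at every `t > 0` which is not an integer multiple of `T`,
`(1/Γ(1-α)) ∫₀^t (t-τ)^(-α) y'(τ) dτ + a y(t-T) = b(t)`. -/
theorem caputo_delay_series_solution_analytic_forcing
    (α a y₀ T : ℝ) (b : ℕ → ℝ) (hα0 : 0 < α) (hα1 : α < 1) (hT : 0 < T)
    (hb : ∀ r : ℝ, 0 ≤ r → Summable (fun k : ℕ => |b k| * r ^ k))
    (y : ℝ → ℝ)
    (hneg : ∀ t : ℝ, t < 0 → y t = 0)
    (hdef : ∀ t : ℝ, 0 ≤ t → y t =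
      ∑ j ∈ Finset.range (⌊t / T⌋₊ + 1),
        (-a) ^ j *
          (y₀ * (t - (j : ℝ) * T) ^ (α * (j : ℝ)) / Real.Gamma (α * (j : ℝ) + 1)
            + ∑' k : ℕ, (Real.Gamma (α * (k : ℝ) + 1) / α ^ k) * b k
                * (t - (j : ℝ) * T) ^ (((j : ℝ) + (k : ℝ) + 1) * α)
                / Real.Gamma (((j : ℝ) + (k : ℝ) + 1) * α + 1))) :
    y 0 = y₀
    ∧ (∀ t : ℝ, 0 ≤ t → ∀ j : ℕ, Summable (fun k : ℕ =>
        (Real.Gamma (α * (k : ℝ) + 1) / α ^ k) * b k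
          * (t - (j : ℝ) * T) ^ (((j : ℝ) + (k : ℝ) + 1) * α)
          / Real.Gamma (((j : ℝ) + (k : ℝ) + 1) * α + 1)))
    ∧ ∀ t : ℝ, 0 < t → (∀ j : ℕ, t ≠ (j : ℝ) * T) →
        (1 / Real.Gamma (1 - α)) * (∫ τ in (0 : ℝ)..t, (t - τ) ^ (-α) * deriv y τ)
          + a * y (t - T)
          = ∑' k : ℕ, b k * (t ^ α / α) ^ k := by
  set c : ℕ → ℝ := fun k => Real.Gamma (α * (k : ℝ) + 1) / α ^ k * b k with hcdef
  have hGpos : ∀ k : ℕ, 0 < Real.Gamma (α * (k : ℝ) + 1) := fun k =>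
    Real.Gamma_pos_of_pos (by positivity)
  have hc : ∀ r : ℝ, 0 ≤ r →
      Summable fun k : ℕ => |c k| * r ^ k / Real.Gamma (α * k + 1) := fun r hr => by
    refine (hb (r / α) (by positivity)).congr fun k => ?_
    have := hGpos k
    simp only [hcdef]
    rw [abs_mul, abs_of_pos (show 0 < Real.Gamma (α * (k : ℝ) + 1) / α ^ k by positivity), div_pow]
    field_simp
  set d := consSeq y₀ c with hddef
  have hd : ∀ r : ℝ, 0 ≤ r →
      Summable fun k : ℕ => |d k| * r ^ k / Real.Gamma (α * k + 1) := summable_consSeq hα0 y₀ hc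
  have hcomm : ∀ j k : ℕ, (j : ℝ) + k + 1 = ((j + 1 : ℕ) : ℝ) + k := fun j k => by
    push_cast; ring
  have hterm : ∀ (j : ℕ) (s : ℝ),
      y₀ * s ^ (α * (j : ℝ)) / Real.Gamma (α * (j : ℝ) + 1)
        + ∑' k : ℕ, c k * s ^ (((j : ℝ) + (k : ℝ) + 1) * α)
          / Real.Gamma (((j : ℝ) + (k : ℝ) + 1) * α + 1) = fracSeries α d j s := fun j s => by
    rw [hddef, fracSeries_consSeq hα0 y₀ hc, fracSeries, mul_comm α]
    simp_rw [hcomm]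
  have hy : ∀ N : ℕ, ∀ t : ℝ, t < N * T →
      y t = ∑ j ∈ Finset.range N, (-a) ^ j * causalSeries α d j (t - j * T) := by
    intro N t htN
    rcases lt_or_ge t 0 with ht | ht
    · rw [hneg t ht]
      refine (Finset.sum_eq_zero fun j _ => ?_).symm
      rw [causalSeries, if_neg, mul_zero]
      have : 0 ≤ (j : ℝ) * T := by positivity
      linarith
    · rw [hdef t ht]
      have hmem : ∀ j : ℕ, j ∈ Finset.range (⌊t / T⌋₊ + 1) ↔ (j : ℝ) * T ≤ t := fun j => by
        rw [Finset.mem_range, Nat.lt_succ_iff, Nat.le_floor_iff (by positivity), le_div_iff₀ hT]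
      have hsub : Finset.range (⌊t / T⌋₊ + 1) ⊆ Finset.range N := fun j hj => by
        rw [hmem] at hj
        have := lt_of_mul_lt_mul_right (hj.trans_lt htN) hT.le
        exact Finset.mem_range.2 (by exact_mod_cast this)
      rw [← Finset.sum_subset hsub]
      · refine Finset.sum_congr rfl fun j hj => ?_
        rw [hmem] at hj
        rw [hterm, causalSeries, if_pos (by linarith)]
      · intro j _ hj
        rw [hmem] at hj
        rw [causalSeries, if_neg (by linarith), mul_zero]
  refine ⟨?_, fun t _ j => ?_, fun t ht htj => ?_⟩
  · rw [hdef 0 le_rfl]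
    have hz : ∀ k : ℕ, (0 : ℝ) ^ (((k : ℝ) + 1) * α) = 0 := fun k =>
      Real.zero_rpow (by positivity)
    simp [hz]
  · refine (summable_fracSeries hα0 hc (j + 1) (t - j * T)).congr fun k => ?_
    rw [hcomm]
  · obtain ⟨M, hM⟩ : ∃ M : ℕ, t < M * T := by
      obtain ⟨M, hM⟩ := exists_nat_gt (t / T)
      exact ⟨M, (div_lt_iff₀ hT).1 hM⟩
    have hM1 : t < ((M + 1 : ℕ) : ℝ) * T := by push_cast; linarith
    have hderiv : ∀ τ : ℝ, τ < ((M + 1 : ℕ) : ℝ) * T → (∀ j : ℕ, τ ≠ j * T) →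
        deriv y τ = ∑ j ∈ Finset.range (M + 1), (-a) ^ j * causalDeriv α d j (τ - j * T) := by
      intro τ hτ hτj
      have h : HasDerivAt (fun τ => ∑ j ∈ Finset.range (M + 1),
          (-a) ^ j * causalSeries α d j (τ - j * T))
          (∑ j ∈ Finset.range (M + 1), (-a) ^ j * causalDeriv α d j (τ - j * T)) τ :=
        HasDerivAt.fun_sum fun j _ =>
          ((hasDerivAt_causalSeries hα0 hd j (sub_ne_zero.2 (hτj j))).comp_sub_const τ
            ((j : ℝ) * T)).const_mul _
      refine (h.congr_of_eventuallyEq ?_).deriv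
      filter_upwards [Iio_mem_nhds hτ] with z hz using hy (M + 1) z hz
    have hnull : ∀ᵐ τ : ℝ, ∀ j : ℕ, τ ≠ j * T :=
      ae_all_iff.2 fun j => Measure.ae_ne volume _
    have hstep : ∀ j : ℕ,
        IntervalIntegrable (fun τ => (t - τ) ^ (-α) * causalDeriv α d (j + 1)
          (τ - (j + 1 : ℕ) * T)) volume 0 t ∧
        ∫ τ in (0 : ℝ)..t, (t - τ) ^ (-α) * causalDeriv α d (j + 1) (τ - (j + 1 : ℕ) * T)
          = Real.Gamma (1 - α) * causalSeries α d j (t - (j + 1 : ℕ) * T) := fun j =>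
      integral_kernel_mul_causalDeriv_comp_sub hα0 hα1 hd j ht (by positivity) (htj _)
    have hbase : IntervalIntegrable (fun τ => (t - τ) ^ (-α) * causalDeriv α d 0
          (τ - (0 : ℕ) * T)) volume 0 t ∧
        ∫ τ in (0 : ℝ)..t, (t - τ) ^ (-α) * causalDeriv α d 0 (τ - (0 : ℕ) * T)
          = Real.Gamma (1 - α) * fracSeries α c 0 t := by
      rw [hddef, causalDeriv_consSeq_zero hα0 y₀ hc]
      simpa using integral_kernel_mul_causalDeriv hα0 hα1 hc 0 ht
    have hint : ∀ j : ℕ, IntervalIntegrable (fun τ => (t - τ) ^ (-α) * causalDeriv α d j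
        (τ - j * T)) volume 0 t := fun j => by
      cases j with
      | zero => exact hbase.1
      | succ j => exact (hstep j).1
    have hI : ∫ τ in (0 : ℝ)..t, (t - τ) ^ (-α) * deriv y τ
        = ∑ j ∈ Finset.range (M + 1), (-a) ^ j *
          ∫ τ in (0 : ℝ)..t, (t - τ) ^ (-α) * causalDeriv α d j (τ - j * T) := by
      simp_rw [← intervalIntegral.integral_const_mul]
      rw [← intervalIntegral.integral_finsetSum fun j _ => (hint j).const_mul _]
      refine intervalIntegral.integral_congr_ae ?_
      filter_upwards [hnull] with τ hτ hτt
      rw [Set.uIoc_of_le ht.le] at hτt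
      rw [hderiv τ (hτt.2.trans_lt hM1) hτ, Finset.mul_sum]
      exact Finset.sum_congr rfl fun j _ => by ring
    have hforce : fracSeries α c 0 t = ∑' k : ℕ, b k * (t ^ α / α) ^ k := by
      refine tsum_congr fun k => ?_
      have := hGpos k
      simp only [hcdef, Nat.cast_zero, zero_add]
      rw [mul_comm (k : ℝ) α, Real.rpow_mul_natCast ht.le, div_pow]
      field_simp
    have hg := (Real.Gamma_pos_of_pos (show 0 < 1 - α by linarith)).ne'
    have hdelay : ∀ j : ℕ, t - T - j * T = t - (j + 1 : ℕ) * T := fun j => by push_cast; ring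
    rw [hI, Finset.sum_range_succ', hbase.2, hy M (t - T) (by linarith), ← hforce]
    simp_rw [(hstep _).2, hdelay]
    rw [mul_add, Finset.mul_sum, Finset.mul_sum, add_right_comm, ← Finset.sum_add_distrib,
      Finset.sum_eq_zero, zero_add, pow_zero, one_mul, one_div, inv_mul_cancel_left₀ hg]
    intro j _
    field_simp
    ring
end

section
/- Let α ∈ (0,1), a > 0, and b₀, y₀ ∈ ℝ, and let y(t) = y₀ E_α(−a t^α) + (b₀/a)(1 − E_α(−a t^α)), where E_α(z) = ∑_{k=0}^∞ z^k/Γ(αk+1) is the Mittag-Leffler function. Then E_α(−a t^α) → 0 as t → ∞, and consequently y(t) → b₀/a as t → ∞; that is, the solution of the Caputo equation ^C D^α y + a y = b₀ with y(0) = y₀ converges to the equilibrium b₀/a. -/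
open Filter Topology

/-- The Mittag-Leffler function `E_α(z) = ∑_{k=0}^∞ z^k / Γ(αk+1)`. -/
noncomputable def mittagLeffler (α z : ℝ) : ℝ :=
  ∑' k : ℕ, z ^ k / Real.Gamma (α * (k : ℝ) + 1)

open MeasureTheory

theorem rpow_mul_exp_neg_le_Gamma {M s : ℝ} (hM : 0 < M) (hs : 1 ≤ s) :
    M ^ (s - 1) * Real.exp (-M) ≤ Real.Gamma s := by
  have hint := Real.GammaIntegral_convergent (zero_lt_one.trans_le hs)
  have hsub : Set.Ioi M ⊆ Set.Ioi 0 := Set.Ioi_subset_Ioi hM.le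
  rw [Real.Gamma_eq_integral (by linarith), ← integral_exp_neg_Ioi, ← integral_const_mul]
  calc ∫ x in Set.Ioi M, M ^ (s - 1) * Real.exp (-x)
      ≤ ∫ x in Set.Ioi M, Real.exp (-x) * x ^ (s - 1) := by
        refine setIntegral_mono_on ((integrableOn_exp_neg_Ioi M).const_mul _)
          (hint.mono_set hsub) measurableSet_Ioi fun x hx => ?_
        rw [mul_comm]
        have := Real.rpow_le_rpow hM.le (le_of_lt hx) (by linarith : 0 ≤ s - 1)
        gcongr
    _ ≤ _ := by
        refine setIntegral_mono_set hint ?_ hsub.eventuallyLE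
        filter_upwards [ae_restrict_mem measurableSet_Ioi] with x hx
        have : (0 : ℝ) < x := hx
        simp only [Pi.zero_apply]
        positivity

theorem summable_pow_div_Gamma {α : ℝ} (hα : 0 < α) (β x : ℝ) :
    Summable fun k : ℕ => x ^ k / Real.Gamma (α * k + β) := by
  set r : ℝ := 2 * |x| + 1 with hr
  have hr0 : 0 < r := by positivity
  have hxr : |x| / r < 1 := by
    rw [div_lt_one hr0]; linarith [abs_nonneg x]
  set M : ℝ := r ^ (1 / α) with hM
  have hM0 : 0 < M := by positivity
  have hMr : M ^ α = r := by
    rw [hM, ← Real.rpow_mul hr0.le, one_div_mul_cancel hα.ne', Real.rpow_one]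
  refine Summable.of_norm_bounded_eventually_nat
    ((summable_geometric_of_lt_one (by positivity) hxr).mul_left (Real.exp M * M ^ (1 - β))) ?_
  have hlarge : ∀ᶠ k : ℕ in atTop, 1 ≤ α * k + β :=
    (tendsto_atTop_add_const_right _ β
      (tendsto_natCast_atTop_atTop.const_mul_atTop hα)).eventually_ge_atTop 1
  filter_upwards [hlarge] with k hk
  have hG := rpow_mul_exp_neg_le_Gamma hM0 hk
  have hG0 : 0 < Real.Gamma (α * k + β) := Real.Gamma_pos_of_pos (by linarith)
  have hpow : M ^ (α * k + β - 1) = r ^ k * (M ^ (1 - β))⁻¹ := by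
    rw [← Real.rpow_neg hM0.le, ← hMr, ← Real.rpow_mul_natCast hM0.le, ← Real.rpow_add hM0]
    congr 1; ring
  have hN : 0 < M ^ (1 - β) := by positivity
  rw [norm_div, norm_pow, Real.norm_eq_abs, Real.norm_of_nonneg hG0.le]
  refine (div_le_div_of_nonneg_left (by positivity) (by positivity) hG).trans (le_of_eq ?_)
  rw [hpow, Real.exp_neg, div_pow]
  field_simp

theorem integral_sub_rpow_mul_rpow_s19 {β γ t : ℝ} (hβ : 0 < β) (hγ : 0 < γ) (ht : 0 < t) :
    ∫ s in 0..t, (t - s) ^ (γ - 1) * s ^ (β - 1) =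
      t ^ (β + γ - 1) * ProbabilityTheory.beta β γ := by
  have h := Complex.betaIntegral_scaled β γ ht
  rw [Complex.betaIntegral_eq_Gamma_mul_div _ _ (by simpa) (by simpa)] at h
  have hcongr : ∫ s in 0..t, (s : ℂ) ^ ((β : ℂ) - 1) * ((t : ℂ) - s) ^ ((γ : ℂ) - 1) =
      ∫ s in 0..t, (((t - s) ^ (γ - 1) * s ^ (β - 1) : ℝ) : ℂ) := by
    refine intervalIntegral.integral_congr fun s hs => ?_
    rw [Set.uIcc_of_le ht.le] at hs
    push_cast [Complex.ofReal_cpow hs.1, Complex.ofReal_cpow (sub_nonneg.2 hs.2)]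
    ring
  rw [hcongr, intervalIntegral.integral_ofReal] at h
  have ht' : (t : ℂ) ^ ((β : ℂ) + γ - 1) = ((t ^ (β + γ - 1) : ℝ) : ℂ) := by
    push_cast [Complex.ofReal_cpow ht.le]; rfl
  rw [ht', ← Complex.ofReal_add, Complex.Gamma_ofReal, Complex.Gamma_ofReal,
    Complex.Gamma_ofReal] at h
  exact_mod_cast h

theorem intervalIntegrable_sub_rpow_mul_rpow_s19 {β γ t : ℝ} (hβ : 0 < β) (hγ : 0 < γ)
    (ht : 0 < t) :
    IntervalIntegrable (fun s => (t - s) ^ (γ - 1) * s ^ (β - 1)) volume 0 t := by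
  by_contra h
  have := intervalIntegral.integral_undef h
  rw [integral_sub_rpow_mul_rpow_s19 hβ hγ ht] at this
  have := ProbabilityTheory.beta_pos hβ hγ
  have : 0 < t ^ (β + γ - 1) * ProbabilityTheory.beta β γ := by positivity
  linarith

/-- The two-parameter Mittag-Leffler function `E_{α,β}(z) = ∑_{k=0}^∞ z^k / Γ(αk+β)`. -/
noncomputable def mittagLefflerTwo (α β z : ℝ) : ℝ :=
  ∑' k : ℕ, z ^ k / Real.Gamma (α * k + β)

/-- The function `t^{β-1} E_{α,β}(-t^α)`. -/
noncomputable def mittagLefflerRelaxation (α β t : ℝ) : ℝ :=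
  t ^ (β - 1) * mittagLefflerTwo α β (-t ^ α)

section MittagLefflerRelaxation

variable {α β γ t : ℝ}

theorem continuous_mittagLefflerTwo (hα : 0 < α) (β : ℝ) :
    Continuous (mittagLefflerTwo α β) := by
  refine continuous_iff_continuousAt.2 fun z => ?_
  have hon : ContinuousOn (mittagLefflerTwo α β) (Metric.ball 0 (|z| + 1)) := by
    refine continuousOn_tsum (fun k => by fun_prop)
      (summable_pow_div_Gamma hα β (|z| + 1)).norm fun k x hx => ?_
    rw [norm_div, norm_div, norm_pow, norm_pow]
    have hx : ‖x‖ ≤ ‖|z| + 1‖ := by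
      rw [Real.norm_of_nonneg (by positivity : 0 ≤ |z| + 1)]
      simpa using (Metric.mem_ball.1 hx).le
    gcongr
  exact hon.continuousAt (Metric.isOpen_ball.mem_nhds (by simp))

theorem hasSum_mittagLefflerRelaxation (hα : 0 < α) (β : ℝ) (ht : 0 < t) :
    HasSum (fun k : ℕ => (-1) ^ k * t ^ (α * k + β - 1) / Real.Gamma (α * k + β))
      (mittagLefflerRelaxation α β t) := by
  rw [mittagLefflerRelaxation, mittagLefflerTwo]
  convert! (summable_pow_div_Gamma hα β (-t ^ α)).hasSum.mul_left (t ^ (β - 1)) using 2 with k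
  rw [neg_pow (t ^ α), ← Real.rpow_mul_natCast ht.le, mul_div_assoc', mul_left_comm,
    ← Real.rpow_add ht]
  ring_nf

theorem mittagLefflerRelaxation_add (hα : 0 < α) (β : ℝ) (ht : 0 < t) :
    mittagLefflerRelaxation α (β + α) t =
      t ^ (β - 1) / Real.Gamma β - mittagLefflerRelaxation α β t := by
  have h := (hasSum_nat_add_iff' 1).2 (hasSum_mittagLefflerRelaxation hα β ht)
  have h' := (hasSum_mittagLefflerRelaxation hα (β + α) ht).neg
  have := h.unique (by
    convert! h' using 2 with k
    push_cast
    rw [pow_succ, show α * (k + 1) + β = α * k + (β + α) by ring]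
    ring)
  simp at this
  linarith

theorem continuousOn_mittagLefflerRelaxation (hα : 0 < α) (β : ℝ) :
    ContinuousOn (mittagLefflerRelaxation α β) (Set.Ioi 0) := by
  refine ContinuousOn.mul (fun x hx => ?_) ?_
  · exact (Real.continuousAt_rpow_const x _ (Or.inl (ne_of_gt hx))).continuousWithinAt
  · exact ((continuous_mittagLefflerTwo hα β).comp
      (Real.continuous_rpow_const hα.le).neg).continuousOn

theorem intervalIntegrable_sub_rpow_mul_mittagLefflerRelaxation (hα : 0 < α) (hβ : 0 < β)
    (hγ : 0 < γ) (ht : 0 < t) :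
    IntervalIntegrable (fun s => (t - s) ^ (γ - 1) * mittagLefflerRelaxation α β s)
      volume 0 t := by
  have := (intervalIntegrable_sub_rpow_mul_rpow_s19 hβ hγ ht).mul_continuousOn
    ((continuous_mittagLefflerTwo hα β).comp (Real.continuous_rpow_const hα.le).neg).continuousOn
  simpa only [mittagLefflerRelaxation, mul_assoc, Function.comp_apply, Pi.neg_apply] using this

theorem integral_sub_rpow_mul_mittagLefflerRelaxation (hα : 0 < α) (hβ : 0 < β)
    (hγ : 0 < γ) (ht : 0 < t) :
    ∫ s in 0..t, (t - s) ^ (γ - 1) * mittagLefflerRelaxation α β s =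
      Real.Gamma γ * mittagLefflerRelaxation α (β + γ) t := by
  set F : ℕ → ℝ → ℝ := fun k s => (-1) ^ k / Real.Gamma (α * k + β) *
    ((t - s) ^ (γ - 1) * s ^ (α * k + β - 1)) with hF
  have hpos (k : ℕ) : 0 < α * k + β := by positivity
  have hint (k : ℕ) : IntervalIntegrable (F k) volume 0 t :=
    (intervalIntegrable_sub_rpow_mul_rpow_s19 (hpos k) hγ ht).const_mul _
  have hbeta (k : ℕ) : (Real.Gamma (α * k + β))⁻¹ *
      (t ^ (α * k + β + γ - 1) * ProbabilityTheory.beta (α * k + β) γ) =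
      Real.Gamma γ * (t ^ (α * k + (β + γ) - 1) / Real.Gamma (α * k + (β + γ))) := by
    have := (Real.Gamma_pos_of_pos (hpos k)).ne'
    rw [ProbabilityTheory.beta, ← add_assoc]
    field_simp
  have hval (k : ℕ) : ∫ s in Set.Ioc 0 t, F k s = Real.Gamma γ *
      ((-1) ^ k * t ^ (α * k + (β + γ) - 1) / Real.Gamma (α * k + (β + γ))) := by
    rw [← intervalIntegral.integral_of_le ht.le, intervalIntegral.integral_const_mul,
      integral_sub_rpow_mul_rpow_s19 (hpos k) hγ ht, div_eq_mul_inv, mul_assoc, hbeta]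
    ring
  have hnorm (k : ℕ) : ∫ s in Set.Ioc 0 t, ‖F k s‖ = Real.Gamma γ *
      (t ^ (α * k + (β + γ) - 1) / Real.Gamma (α * k + (β + γ))) := by
    rw [← hbeta, ← integral_sub_rpow_mul_rpow_s19 (hpos k) hγ ht,
      ← intervalIntegral.integral_const_mul, intervalIntegral.integral_of_le ht.le]
    refine setIntegral_congr_fun measurableSet_Ioc fun s hs => ?_
    have h1 := Real.rpow_nonneg (sub_nonneg.2 hs.2) (γ - 1)
    have h2 := Real.rpow_nonneg hs.1.le (α * k + β - 1)
    simp only [hF, norm_mul, norm_div, norm_pow, norm_neg, norm_one, one_pow, one_div,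
      Real.norm_of_nonneg h1, Real.norm_of_nonneg h2,
      Real.norm_of_nonneg (Real.Gamma_pos_of_pos (hpos k)).le]
  have hsummable : Summable fun k => ∫ s in Set.Ioc 0 t, ‖F k s‖ := by
    simp_rw [hnorm]
    refine Summable.mul_left _ ?_
    convert! (hasSum_mittagLefflerRelaxation hα (β + γ) ht).summable.norm using 2 with k
    rw [norm_div, norm_mul, norm_pow, norm_neg, norm_one, one_pow, one_mul,
      Real.norm_of_nonneg (by positivity), Real.norm_of_nonneg]
    exact (Real.Gamma_pos_of_pos (by positivity)).le
  have hsum := hasSum_integral_of_summable_integral_norm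
    (fun k => (intervalIntegrable_iff_integrableOn_Ioc_of_le ht.le).1 (hint k)) hsummable
  simp_rw [hval] at hsum
  rw [← hsum.unique ((hasSum_mittagLefflerRelaxation hα (β + γ) ht).mul_left _),
    intervalIntegral.integral_of_le ht.le]
  refine setIntegral_congr_fun measurableSet_Ioc fun s hs => ?_
  have hs' := (hasSum_mittagLefflerRelaxation hα β hs.1).mul_left ((t - s) ^ (γ - 1))
  simp only [← hs'.tsum_eq, hF]
  congr 1 with k
  ring

theorem intervalIntegrable_mittagLefflerRelaxation (hα : 0 < α) (hβ : 0 < β) (ht : 0 < t) :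
    IntervalIntegrable (mittagLefflerRelaxation α β) volume 0 t := by
  simpa using intervalIntegrable_sub_rpow_mul_mittagLefflerRelaxation hα hβ one_pos ht

theorem integral_mittagLefflerRelaxation (hα : 0 < α) (hβ : 0 < β) (ht : 0 < t) :
    ∫ s in 0..t, mittagLefflerRelaxation α β s = mittagLefflerRelaxation α (β + 1) t := by
  simpa using integral_sub_rpow_mul_mittagLefflerRelaxation hα hβ one_pos ht

theorem integral_sub_rpow_mul_mittagLefflerRelaxation_self (hα : 0 < α) (hβ : 0 < β)
    (ht : 0 < t) :
    ∫ s in 0..t, (t - s) ^ (α - 1) * mittagLefflerRelaxation α β s =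
      Real.Gamma α * (t ^ (β - 1) / Real.Gamma β - mittagLefflerRelaxation α β t) := by
  rw [integral_sub_rpow_mul_mittagLefflerRelaxation hα hβ hα ht,
    mittagLefflerRelaxation_add hα β ht]

/-- `t^{α-1} E_{α,α}(-t^α)` has no first zero on `(0, ∞)`. -/
theorem mittagLefflerRelaxation_pos_of_forall_lt (hα0 : 0 < α) (hα1 : α < 1) {t₀ : ℝ}
    (ht₀ : 0 < t₀) (hpos : ∀ s, 0 < s → s < t₀ → 0 < mittagLefflerRelaxation α α s) :
    0 < mittagLefflerRelaxation α α t₀ := by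
  set h := mittagLefflerRelaxation α α with hh
  by_contra! hneg
  have hG := Real.Gamma_pos_of_pos hα0
  obtain ⟨t₁, ht₁, ht₁₀, hsmall⟩ :
      ∃ t₁, t₀ / 2 < t₁ ∧ t₁ < t₀ ∧ (t₀ - t₁) ^ α / α < Real.Gamma α / 2 := by
    have hcont : Continuous fun s => (t₀ - s) ^ α / α :=
      ((Real.continuous_rpow_const hα0.le).comp (continuous_const.sub continuous_id)).div_const _
    have hlim : ∀ᶠ s in 𝓝[<] t₀, (t₀ - s) ^ α / α < Real.Gamma α / 2 := by
      refine (hcont.continuousWithinAt.eventually_lt_const ?_)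
      simp only [sub_self, Real.zero_rpow hα0.ne', zero_div]
      positivity
    obtain ⟨s, h1, h2⟩ := (hlim.and (Ioo_mem_nhdsLT (by linarith : t₀ / 2 < t₀))).exists
    exact ⟨s, h2.1, h2.2, h1⟩
  have hsub : Set.Icc t₁ t₀ ⊆ Set.Ioi 0 := fun s hs => by
    have := hs.1
    simp only [Set.mem_Ioi]
    linarith
  obtain ⟨t, ht, hmax⟩ := isCompact_Icc.exists_isMaxOn (Set.nonempty_Icc.2 ht₁₀.le)
    ((continuousOn_mittagLefflerRelaxation hα0 α).mono hsub)
  have ht0 : 0 < t := hsub ht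
  have hht : 0 < h t :=
    (hpos t₁ (by linarith) ht₁₀).trans_le (hmax (Set.left_mem_Icc.2 ht₁₀.le))
  have htt₀ : t < t₀ := lt_of_le_of_ne ht.2 fun he => by rw [he] at hht; linarith
  have hint := intervalIntegrable_sub_rpow_mul_mittagLefflerRelaxation hα0 hα0 hα0 ht₀
  have hint_t := intervalIntegrable_sub_rpow_mul_mittagLefflerRelaxation hα0 hα0 hα0 ht0
  have hint₁ := hint.mono_set (c := 0) (d := t) (by
    rw [Set.uIcc_of_le ht0.le, Set.uIcc_of_le ht₀.le]; exact Set.Icc_subset_Icc_right ht.2)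
  have hint₂ := hint.mono_set (c := t) (d := t₀) (by
    rw [Set.uIcc_of_le ht.2, Set.uIcc_of_le ht₀.le]; exact Set.Icc_subset_Icc_left ht0.le)
  have hkernel : IntervalIntegrable (fun s => (t₀ - s) ^ (α - 1)) volume t t₀ := by
    have := (intervalIntegral.intervalIntegrable_rpow' (a := t₀ - t) (b := 0)
      (by linarith : -1 < α - 1)).comp_sub_left t₀
    simpa using this
  have hhead : ∫ s in 0..t, (t₀ - s) ^ (α - 1) * h s ≤
      (t₀ / t) ^ (α - 1) * (Real.Gamma α * (t ^ (α - 1) / Real.Gamma α - h t)) := by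
    rw [hh, ← integral_sub_rpow_mul_mittagLefflerRelaxation_self hα0 hα0 ht0,
      ← intervalIntegral.integral_const_mul]
    refine intervalIntegral.integral_mono_on_of_le_Ioo ht0.le hint₁ (hint_t.const_mul _)
      fun s hs => ?_
    rw [← mul_assoc, ← Real.mul_rpow (by positivity) (by linarith [hs.2])]
    refine mul_le_mul_of_nonneg_right ?_ (hpos s hs.1 (hs.2.trans htt₀)).le
    have hts : 0 < t - s := sub_pos.2 hs.2
    refine Real.rpow_le_rpow_of_nonpos (by positivity) ?_ (by linarith)
    rw [div_mul_eq_mul_div, div_le_iff₀ ht0]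
    nlinarith [hs.1]
  have htail : ∫ s in t..t₀, (t₀ - s) ^ (α - 1) * h s ≤ (t₀ - t) ^ α / α * h t := by
    have hval : ∫ s in t..t₀, (t₀ - s) ^ (α - 1) = (t₀ - t) ^ α / α := by
      rw [intervalIntegral.integral_comp_sub_left (fun s => s ^ (α - 1)) t₀,
        integral_rpow (Or.inl (by linarith))]
      simp [Real.zero_rpow hα0.ne']
    rw [← hval, ← intervalIntegral.integral_mul_const]
    refine intervalIntegral.integral_mono_on htt₀.le hint₂ (hkernel.mul_const _) fun s hs => ?_
    exact mul_le_mul_of_nonneg_left (hmax ⟨ht.1.trans hs.1, hs.2⟩)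
      (Real.rpow_nonneg (sub_nonneg.2 hs.2) _)
  have hsplit := intervalIntegral.integral_add_adjacent_intervals hint₁ hint₂
  rw [integral_sub_rpow_mul_mittagLefflerRelaxation_self hα0 hα0 ht₀, ← hh] at hsplit
  have hratio : 1 / 2 ≤ (t₀ / t) ^ (α - 1) := by
    have h1 : t₀ / t ≤ 2 := by rw [div_le_iff₀ ht0]; linarith [ht.1]
    have h2 : 1 ≤ t₀ / t := by rw [le_div_iff₀ ht0]; linarith
    calc (1 : ℝ) / 2 = 2 ^ (-1 : ℝ) := by rw [Real.rpow_neg_one]; norm_num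
      _ ≤ (t₀ / t) ^ (-1 : ℝ) := Real.rpow_le_rpow_of_nonpos (by positivity) h1 (by norm_num)
      _ ≤ (t₀ / t) ^ (α - 1) := Real.rpow_le_rpow_of_exponent_le h2 (by linarith)
  have hpow : (t₀ / t) ^ (α - 1) * t ^ (α - 1) = t₀ ^ (α - 1) := by
    rw [← Real.mul_rpow (by positivity) ht0.le, div_mul_cancel₀ _ ht0.ne']
  have hδ : (t₀ - t) ^ α / α ≤ (t₀ - t₁) ^ α / α := by
    have := sub_nonneg.2 ht.2
    have := ht.1
    gcongr
  have hcoef : (t₀ - t) ^ α / α < Real.Gamma α * (t₀ / t) ^ (α - 1) := by nlinarith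
  have hcancel (x y : ℝ) : Real.Gamma α * (x / Real.Gamma α - y) = x - Real.Gamma α * y := by
    field_simp
  rw [hcancel] at hhead hsplit
  rw [mul_sub, hpow] at hhead
  have h1 := mul_lt_mul_of_pos_right hcoef hht
  have h2 := mul_nonneg hG.le (neg_nonneg.2 hneg)
  linarith

theorem mittagLefflerTwo_zero (α β : ℝ) : mittagLefflerTwo α β 0 = (Real.Gamma β)⁻¹ := by
  rw [mittagLefflerTwo, tsum_eq_single 0 fun k hk => by simp [hk]]
  simp

theorem mittagLefflerRelaxation_self_pos (hα0 : 0 < α) (hα1 : α < 1) (ht : 0 < t) :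
    0 < mittagLefflerRelaxation α α t := by
  by_contra! hneg
  set φ : ℝ → ℝ := fun s => mittagLefflerTwo α α (-s ^ α) with hφ
  have hφc : Continuous φ :=
    (continuous_mittagLefflerTwo hα0 α).comp (Real.continuous_rpow_const hα0.le).neg
  have hiff {s : ℝ} (hs : 0 < s) : 0 < mittagLefflerRelaxation α α s ↔ 0 < φ s :=
    mul_pos_iff_of_pos_left (Real.rpow_pos_of_pos hs _)
  have hφ0 : 0 < φ 0 := by
    simpa [hφ, Real.zero_rpow hα0.ne', mittagLefflerTwo_zero] using Real.Gamma_pos_of_pos hα0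
  obtain ⟨t₀, ⟨ht₀, hφt₀⟩, hleast⟩ :=
    (isCompact_Icc.inter_right (isClosed_Iic.preimage hφc)).exists_isLeast
      (s := Set.Icc 0 t ∩ φ ⁻¹' Set.Iic 0)
      ⟨t, Set.right_mem_Icc.2 ht.le, not_lt.1 fun h => hneg.not_gt ((hiff ht).2 h)⟩
  have ht₀pos : 0 < t₀ := lt_of_le_of_ne ht₀.1 fun he => by
    rw [← he] at hφt₀; exact hφ0.not_ge hφt₀
  refine ((hiff ht₀pos).1 (mittagLefflerRelaxation_pos_of_forall_lt hα0 hα1 ht₀pos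
    fun s hs hst => (hiff hs).2 ?_)).not_ge hφt₀
  by_contra! hs'
  exact hst.not_ge (hleast ⟨⟨hs.le, hst.le.trans ht₀.2⟩, hs'⟩)

theorem mittagLefflerRelaxation_one (α t : ℝ) :
    mittagLefflerRelaxation α 1 t = mittagLeffler α (-t ^ α) := by
  simp [mittagLefflerRelaxation, mittagLefflerTwo, mittagLeffler]

theorem integral_mittagLefflerRelaxation_self (hα : 0 < α) (ht : 0 < t) :
    ∫ s in 0..t, mittagLefflerRelaxation α α s = 1 - mittagLefflerRelaxation α 1 t := by
  rw [integral_mittagLefflerRelaxation hα hα ht, add_comm, mittagLefflerRelaxation_add hα 1 ht]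
  simp

theorem mittagLefflerRelaxation_one_nonneg (hα0 : 0 < α) (hα1 : α < 1) (ht : 0 < t) :
    0 ≤ mittagLefflerRelaxation α 1 t := by
  have hG := Real.Gamma_pos_of_pos hα0
  have hle : t ^ (α - 1) * (1 - mittagLefflerRelaxation α 1 t) ≤ t ^ (α - 1) := by
    calc t ^ (α - 1) * (1 - mittagLefflerRelaxation α 1 t)
        = ∫ s in 0..t, t ^ (α - 1) * mittagLefflerRelaxation α α s := by
          rw [intervalIntegral.integral_const_mul, integral_mittagLefflerRelaxation_self hα0 ht]
      _ ≤ ∫ s in 0..t, (t - s) ^ (α - 1) * mittagLefflerRelaxation α α s := by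
          refine intervalIntegral.integral_mono_on_of_le_Ioo ht.le
            ((intervalIntegrable_mittagLefflerRelaxation hα0 hα0 ht).const_mul _)
            (intervalIntegrable_sub_rpow_mul_mittagLefflerRelaxation hα0 hα0 hα0 ht)
            fun s hs => ?_
          refine mul_le_mul_of_nonneg_right ?_ (mittagLefflerRelaxation_self_pos hα0 hα1 hs.1).le
          exact Real.rpow_le_rpow_of_nonpos (sub_pos.2 hs.2) (by linarith [hs.1]) (by linarith)
      _ = t ^ (α - 1) - Real.Gamma α * mittagLefflerRelaxation α α t := by
          rw [integral_sub_rpow_mul_mittagLefflerRelaxation_self hα0 hα0 ht]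
          field_simp
      _ ≤ t ^ (α - 1) :=
          sub_le_self _ (mul_nonneg hG.le (mittagLefflerRelaxation_self_pos hα0 hα1 ht).le)
  have := (mul_le_iff_le_one_right (Real.rpow_pos_of_pos ht (α - 1))).1 hle
  linarith

theorem antitoneOn_mittagLefflerRelaxation_one (hα0 : 0 < α) (hα1 : α < 1) :
    AntitoneOn (mittagLefflerRelaxation α 1) (Set.Ioi 0) := by
  intro s hs t ht hst
  have hint := intervalIntegrable_mittagLefflerRelaxation hα0 hα0 ht
  have hmono := intervalIntegral.integral_mono_interval le_rfl (le_of_lt hs) hst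
    ((ae_restrict_mem measurableSet_Ioc).mono fun x hx =>
      (mittagLefflerRelaxation_self_pos hα0 hα1 hx.1).le) hint
  rw [integral_mittagLefflerRelaxation_self hα0 hs,
    integral_mittagLefflerRelaxation_self hα0 ht] at hmono
  linarith

theorem mittagLefflerRelaxation_one_le (hα0 : 0 < α) (hα1 : α < 1) (ht : 0 < t) :
    mittagLefflerRelaxation α 1 t ≤ Real.Gamma (α + 1) / t ^ α := by
  have hG := Real.Gamma_pos_of_pos hα0
  have hkernel : IntervalIntegrable (fun s => (t - s) ^ (α - 1)) volume 0 t := by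
    simpa using intervalIntegrable_sub_rpow_mul_rpow_s19 one_pos hα0 ht
  have hval : ∫ s in 0..t, (t - s) ^ (α - 1) = t ^ α / α := by
    rw [intervalIntegral.integral_comp_sub_left (fun s => s ^ (α - 1)) t,
      integral_rpow (Or.inl (by linarith))]
    simp [Real.zero_rpow hα0.ne']
  have hle : t ^ α / α * mittagLefflerRelaxation α 1 t ≤
      Real.Gamma α * (1 - mittagLefflerRelaxation α 1 t) := by
    have heq := integral_sub_rpow_mul_mittagLefflerRelaxation_self hα0 one_pos ht
    simp only [sub_self, Real.rpow_zero, Real.Gamma_one, div_one] at heq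
    rw [← heq, ← hval, ← intervalIntegral.integral_mul_const]
    refine intervalIntegral.integral_mono_on_of_le_Ioo ht.le (hkernel.mul_const _)
      (intervalIntegrable_sub_rpow_mul_mittagLefflerRelaxation hα0 one_pos hα0 ht) fun s hs => ?_
    exact mul_le_mul_of_nonneg_left
      (antitoneOn_mittagLefflerRelaxation_one hα0 hα1 hs.1 ht hs.2.le)
      (Real.rpow_nonneg (sub_pos.2 hs.2).le _)
  have hnonneg := mul_nonneg hG.le (mittagLefflerRelaxation_one_nonneg hα0 hα1 ht)
  have hle' : t ^ α / α * mittagLefflerRelaxation α 1 t ≤ Real.Gamma α := by linarith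
  rw [div_mul_eq_mul_div, div_le_iff₀ hα0] at hle'
  rw [le_div_iff₀ (Real.rpow_pos_of_pos ht α), Real.Gamma_add_one hα0.ne']
  linarith

end MittagLefflerRelaxation

theorem tendsto_mittagLeffler_neg_atTop {α : ℝ} (hα0 : 0 < α) (hα1 : α < 1) :
    Tendsto (fun x => mittagLeffler α (-x)) atTop (𝓝 0) := by
  have hroot {x : ℝ} (hx : 0 < x) : (x ^ (1 / α)) ^ α = x := by
    rw [← Real.rpow_mul hx.le, one_div_mul_cancel hα0.ne', Real.rpow_one]
  have heq {x : ℝ} (hx : 0 < x) :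
      mittagLeffler α (-x) = mittagLefflerRelaxation α 1 (x ^ (1 / α)) := by
    rw [mittagLefflerRelaxation_one, hroot hx]
  refine tendsto_of_tendsto_of_tendsto_of_le_of_le' tendsto_const_nhds
    (tendsto_id.const_div_atTop (Real.Gamma (α + 1))) ?_ ?_
  · filter_upwards [eventually_gt_atTop 0] with x hx
    rw [heq hx]
    exact mittagLefflerRelaxation_one_nonneg hα0 hα1 (Real.rpow_pos_of_pos hx _)
  · filter_upwards [eventually_gt_atTop 0] with x hx
    have := mittagLefflerRelaxation_one_le hα0 hα1 (Real.rpow_pos_of_pos hx (1 / α))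
    rwa [hroot hx, ← heq hx] at this

/-- For `α ∈ (0,1)` and `a > 0`, `E_α(-a t^α) → 0` as `t → ∞`, and consequently the
solution `y(t) = y₀ E_α(-a t^α) + (b₀/a)(1 - E_α(-a t^α))` of the Caputo equation
`^C D^α y + a y = b₀`, `y(0) = y₀`, converges to the equilibrium `b₀/a`. -/
theorem caputo_constant_forcing_longtime
    (α a b₀ y₀ : ℝ) (hα0 : 0 < α) (hα1 : α < 1) (ha : 0 < a) :
    Tendsto (fun t : ℝ => mittagLeffler α (-a * t ^ α)) atTop (𝓝 0)
    ∧ Tendsto (fun t : ℝ => y₀ * mittagLeffler α (-a * t ^ α)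
        + (b₀ / a) * (1 - mittagLeffler α (-a * t ^ α))) atTop (𝓝 (b₀ / a)) := by

  have hlim : Tendsto (fun t : ℝ => mittagLeffler α (-a * t ^ α)) atTop (𝓝 0) := by
    simpa only [neg_mul, Function.comp_def] using (tendsto_mittagLeffler_neg_atTop hα0 hα1).comp
      ((tendsto_rpow_atTop hα0).const_mul_atTop ha)
  refine ⟨hlim, ?_⟩
  simpa using (hlim.const_mul y₀).add ((hlim.const_sub 1).const_mul (b₀ / a))
end
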